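/- Suppose Conditions 1.1 and 1.2 are satisfied, and suppose there is a nonnegative twice continuously differentiable function V on [0,∞) with V(x) → ∞ as x → ∞, such that the integrals defining LV(x) converge for all x ≥ 0 and there are constants C₀ > 0, C₁ > 0 with LV(x) ≤ C₀ − C₁V(x) for all x ≥ 0 (Condition 1.3). Define V₀(x,y) = (V(x) + V(y))·1_{x≠y} on D. Then there exist constants x₀ ∈ (0,1), θ ≥ 4, ε > 0 and λ > 0 such that, with F₀ defined from λ₀, x₀, θ and G₀ = εF₀ + V₀, the function G₀ lies in the domain of L̃ and L̃G₀(x,y) ≤ −λ G₀(x,y) for all (x,y) ∈ Δᶜ; one may take λ = (C₁ ∧ λ₂)/2 where λ₂ is the constant of the contraction estimate for F₀. -/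

import Mathlib

open MeasureTheory

/-- For a σ-finite Borel measure `m` on `ℝ` vanishing on `(-∞,0]` and `x ∈ ℝ`,
`mShift m x = ½ (m ∧ T_x m)` where `T_x m` is the image of `m` under `z ↦ z + x`
and `∧` is the infimum in the lattice of measures. -/
noncomputable def mShift (m : Measure ℝ) (x : ℝ) : Measure ℝ :=
  (2⁻¹ : ENNReal) • (m ⊓ Measure.map (fun z => z + x) m)

/-- First partial derivative of `F` in the first variable. -/
noncomputable def Fx (F : ℝ → ℝ → ℝ) (x y : ℝ) : ℝ := deriv (fun t => F t y) x

/-- First partial derivative of `F` in the second variable. -/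
noncomputable def Fy (F : ℝ → ℝ → ℝ) (x y : ℝ) : ℝ := deriv (fun t => F x t) y

/-- Second partial derivative `F″_{xx}`. -/
noncomputable def Fxx (F : ℝ → ℝ → ℝ) (x y : ℝ) : ℝ := deriv (fun t => Fx F t y) x

/-- Second partial derivative `F″_{yy}`. -/
noncomputable def Fyy (F : ℝ → ℝ → ℝ) (x y : ℝ) : ℝ := deriv (fun t => Fy F x t) y

/-- Mixed second partial derivative `F″_{xy}`. -/
noncomputable def Fxy (F : ℝ → ℝ → ℝ) (x y : ℝ) : ℝ := deriv (fun t => Fx F x t) y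

/-- `cutoff z = z 1_{z ≤ 1}`. -/
noncomputable def cutoff (z : ℝ) : ℝ := if z ≤ 1 then z else 0

/-- The part `L̃₀` of the coupling generator. -/
noncomputable def Ltil0 (b c β : ℝ) (g : ℝ → ℝ) (μ ν : Measure ℝ)
    (F : ℝ → ℝ → ℝ) (x y : ℝ) : ℝ :=
  (β - b * x - g x) * Fx F x y + (β - b * y - g y) * Fy F x y
    + c * x * Fxx F x y + c * y * Fyy F x y - 2 * c * y * Fxy F x y
    + (∫ z in Set.Ioi (0 : ℝ), (F (x + z) (y + z) - F x y) ∂ν)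
    + (x - y) * (∫ z in Set.Ioi (0 : ℝ), (F (x + z) y - F x y - Fx F x y * cutoff z) ∂μ)
    + y * (∫ z in Set.Ioi (0 : ℝ),
        (F (x + z) (y + z) - F x y - (Fx F x y + Fy F x y) * cutoff z) ∂μ)

/-- The part `L̃₁` of the coupling generator (induced by the lassoing process). -/
noncomputable def Ltil1 (μ ν : Measure ℝ) (F : ℝ → ℝ → ℝ) (x y : ℝ) : ℝ :=
  y * (∫ z in Set.Ioi (0 : ℝ), (F (x + z) (2 * y + z - x) - F (x + z) (y + z)) ∂(mShift μ (x - y)))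
    + y * (∫ z in Set.Ioi (0 : ℝ), (F (x + z) (x + z) - F (x + z) (y + z)) ∂(mShift μ (y - x)))
    + (∫ z in Set.Ioi (0 : ℝ), (F (x + z) (2 * y + z - x) - F (x + z) (y + z)) ∂(mShift ν (x - y)))
    + (∫ z in Set.Ioi (0 : ℝ), (F (x + z) (x + z) - F (x + z) (y + z)) ∂(mShift ν (y - x)))

/-- The coupling generator `L̃ = L̃₀ + L̃₁`. -/
noncomputable def Ltil (b c β : ℝ) (g : ℝ → ℝ) (μ ν : Measure ℝ)
    (F : ℝ → ℝ → ℝ) (x y : ℝ) : ℝ :=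
  Ltil0 b c β g μ ν F x y + Ltil1 μ ν F x y

/-- `Δᶜ = D ∖ Δ = {(x,y) : 0 ≤ y < x}`. -/
def DeltaC : Set (ℝ × ℝ) := {p | 0 ≤ p.2 ∧ p.2 < p.1}

/-- `F` belongs to the domain of the coupling generator `L̃`: all the integrals
appearing in `L̃₀F` and `L̃₁F` converge at each point of `Δᶜ`, and `L̃F` is
bounded on compact subsets of `Δᶜ`. -/
def InDomLtil (b c β : ℝ) (g : ℝ → ℝ) (μ ν : Measure ℝ) (F : ℝ → ℝ → ℝ) : Prop :=
  (∀ x y : ℝ, 0 ≤ y → y < x →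
    MeasureTheory.IntegrableOn (fun z => F (x + z) (y + z) - F x y) (Set.Ioi 0) ν ∧
    MeasureTheory.IntegrableOn (fun z => F (x + z) y - F x y - Fx F x y * cutoff z)
      (Set.Ioi 0) μ ∧
    MeasureTheory.IntegrableOn
      (fun z => F (x + z) (y + z) - F x y - (Fx F x y + Fy F x y) * cutoff z) (Set.Ioi 0) μ ∧
    MeasureTheory.IntegrableOn (fun z => F (x + z) (2 * y + z - x) - F (x + z) (y + z))
      (Set.Ioi 0) (mShift μ (x - y)) ∧
    MeasureTheory.IntegrableOn (fun z => F (x + z) (x + z) - F (x + z) (y + z))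
      (Set.Ioi 0) (mShift μ (y - x)) ∧
    MeasureTheory.IntegrableOn (fun z => F (x + z) (2 * y + z - x) - F (x + z) (y + z))
      (Set.Ioi 0) (mShift ν (x - y)) ∧
    MeasureTheory.IntegrableOn (fun z => F (x + z) (x + z) - F (x + z) (y + z))
      (Set.Ioi 0) (mShift ν (y - x))) ∧
  (∀ K : Set (ℝ × ℝ), K ⊆ DeltaC → IsCompact K →
    ∃ M : ℝ, ∀ p ∈ K, |Ltil b c β g μ ν F p.1 p.2| ≤ M)

/-- The branching mechanism `Ψ(λ) = bλ + cλ² + ∫₀^∞(e^{−λz} − 1 + λz 1_{z≤1}) μ(dz)`. -/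
noncomputable def Psi (b c : ℝ) (μ : Measure ℝ) (l : ℝ) : ℝ :=
  b * l + c * l ^ 2
    + ∫ z in Set.Ioi (0 : ℝ), (Real.exp (-(l * z)) - 1 + l * cutoff z) ∂μ

/-- The immigration mechanism `Φ(λ) = βλ + ∫₀^∞(1 − e^{−λz}) ν(dz)`. -/
noncomputable def Phi (β : ℝ) (ν : Measure ℝ) (l : ℝ) : ℝ :=
  β * l + ∫ z in Set.Ioi (0 : ℝ), (1 - Real.exp (-(l * z))) ∂ν

/-- `ψ(x) = 1 − e^{−λ₀ x}`. -/
noncomputable def psi0 (lam0 x : ℝ) : ℝ := 1 - Real.exp (-(lam0 * x))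

/-- `φ(x) = θ + (1 − x/x₀)³` for `0 ≤ x < x₀`, and `φ(x) = θ` for `x ≥ x₀`. -/
noncomputable def phi0 (x0 θ x : ℝ) : ℝ := if x < x0 then θ + (1 - x / x0) ^ 3 else θ

/-- `F₀(x,y) = φ(x)[1 + ψ(x−y)] 1_{x≠y}`. -/
noncomputable def F0 (lam0 x0 θ : ℝ) (x y : ℝ) : ℝ :=
  if x = y then 0 else phi0 x0 θ x * (1 + psi0 lam0 (x - y))

/-- The generator `L` of the CBIC-process acting on a `C²` function `V`. -/
noncomputable def genL (b c β : ℝ) (g : ℝ → ℝ) (μ ν : Measure ℝ)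
    (V : ℝ → ℝ) (x : ℝ) : ℝ :=
  c * x * deriv (deriv V) x
    + x * (∫ z in Set.Ioi (0 : ℝ), (V (x + z) - V x - deriv V x * cutoff z) ∂μ)
    + (β - b * x - g x) * deriv V x
    + (∫ z in Set.Ioi (0 : ℝ), (V (x + z) - V x) ∂ν)

/-- `G₀ = ε F₀ + V₀`, where `V₀(x,y) = (V(x)+V(y)) 1_{x≠y}`. -/
noncomputable def G0 (lam0 x0 θ ε : ℝ) (V : ℝ → ℝ) (x y : ℝ) : ℝ :=
  ε * F0 lam0 x0 θ x y + (if x = y then 0 else V x + V y)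

theorem integrableOn_Ioi_of_abs_le {m : Measure ℝ} {w f : ℝ → ℝ} {C : ℝ}
    (hw : IntegrableOn w (Set.Ioi 0) m) (hf : Measurable f)
    (hle : ∀ z, 0 < z → |f z| ≤ C * w z) : IntegrableOn f (Set.Ioi 0) m := by
  refine (hw.const_mul C).mono' hf.aestronglyMeasurable ?_
  filter_upwards [ae_restrict_mem measurableSet_Ioi] with z hz
  simpa using hle z hz

theorem abs_setIntegral_Ioi_le {m : Measure ℝ} {w f : ℝ → ℝ} {C : ℝ}
    (hw : IntegrableOn w (Set.Ioi 0) m)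
    (hle : ∀ z, 0 < z → |f z| ≤ C * w z) :
    |∫ z in Set.Ioi (0 : ℝ), f z ∂m| ≤ C * ∫ z in Set.Ioi (0 : ℝ), w z ∂m := by
  rw [← integral_const_mul, ← Real.norm_eq_abs]
  refine norm_integral_le_of_norm_le (hw.const_mul C) ?_
  filter_upwards [ae_restrict_mem measurableSet_Ioi] with z hz
  simpa using hle z hz

theorem integrableOn_Ioi_of_lintegral_lt_top {m : Measure ℝ} {w : ℝ → ℝ} (hw : Measurable w)
    (hpos : ∀ z, 0 < z → 0 ≤ w z) (hfin : ∫⁻ z, ENNReal.ofReal (w z) ∂m < ⊤) :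
    IntegrableOn w (Set.Ioi 0) m := by
  refine ⟨hw.aestronglyMeasurable, ?_⟩
  rw [hasFiniteIntegral_iff_ofReal]
  · exact (setLIntegral_le_lintegral _ _).trans_lt hfin
  · filter_upwards [ae_restrict_mem measurableSet_Ioi] with z hz
    exact hpos z hz

theorem measure_Ioi_lt_top_of_integrableOn {m : Measure ℝ} {w : ℝ → ℝ}
    (hw : IntegrableOn w (Set.Ioi 0) m) {δ a : ℝ} (hδ : 0 < δ) (ha : 0 < a)
    (hle : ∀ z, δ < z → a ≤ w z) : m (Set.Ioi δ) < ⊤ := by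
  refine lt_of_le_of_lt ?_ (hw.measure_norm_ge_lt_top ha)
  rw [← Measure.restrict_eq_self m (Set.Ioi_subset_Ioi hδ.le)]
  refine measure_mono fun z hz => ?_
  exact (hle z hz).trans (le_abs_self _)

theorem mShift_le_self (m : Measure ℝ) (s : ℝ) : mShift m s ≤ m := by
  calc mShift m s ≤ (1 : ENNReal) • (m ⊓ Measure.map (fun z => z + s) m) := by
        rw [mShift]
        gcongr
        simp
    _ ≤ m := by rw [one_smul]; exact inf_le_left

theorem mShift_le_map (m : Measure ℝ) (s : ℝ) :
    mShift m s ≤ (2⁻¹ : ENNReal) • Measure.map (fun z => z + s) m := by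
  rw [mShift]
  gcongr
  exact inf_le_right

theorem map_add_map_neg (m : Measure ℝ) (s : ℝ) :
    Measure.map (fun z => z + s) (Measure.map (fun z => z + -s) m) = m := by
  rw [Measure.map_map (by fun_prop) (by fun_prop)]
  convert Measure.map_id
  ext z
  simp

theorem mShift_eq_map (m : Measure ℝ) (s : ℝ) :
    mShift m s = Measure.map (fun z => z + s) (mShift m (-s)) := by
  rw [mShift, mShift, Measure.map_smul]
  congr 1
  apply le_antisymm
  · rw [← map_add_map_neg (m ⊓ Measure.map (fun z => z + s) m) s]
    refine Measure.map_mono (le_inf ?_ ?_) (by fun_prop)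
    · calc _ ≤ Measure.map (fun z => z + -s) (Measure.map (fun z => z + s) m) :=
            Measure.map_mono inf_le_right (by fun_prop)
        _ = m := by simpa using map_add_map_neg m (-s)
    · exact Measure.map_mono inf_le_left (by fun_prop)
  · refine le_inf ?_ ?_
    · exact (Measure.map_mono inf_le_right (by fun_prop)).trans (map_add_map_neg m s).le
    · exact Measure.map_mono inf_le_left (by fun_prop)

theorem mShift_neg_Ioi_lt_top {m : Measure ℝ} {u : ℝ} (hfin : m (Set.Ioi u) < ⊤) :
    mShift m (-u) (Set.Ioi 0) < ⊤ := by
  refine (mShift_le_map m (-u) _).trans_lt ?_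
  rw [Measure.smul_apply, Measure.map_apply (by fun_prop) measurableSet_Ioi]
  have : (fun z : ℝ => z + -u) ⁻¹' Set.Ioi 0 = Set.Ioi u := by ext z; simp
  rw [this]
  exact ENNReal.mul_lt_top (by simp) hfin

theorem restrict_Ioi_mShift {m : Measure ℝ} (h0 : m (Set.Iic 0) = 0) (u : ℝ) :
    (mShift m u).restrict (Set.Ioi 0)
      = Measure.map (fun z => z + u) ((mShift m (-u)).restrict (Set.Ioi 0)) := by
  have key : ∀ s, (mShift m s).restrict (Set.Ioi 0) = mShift m s := fun s => by
    rw [Measure.restrict_eq_self_of_ae_mem]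
    refine (mShift_le_self m _).absolutelyContinuous.ae_le ?_
    rw [mem_ae_iff]
    simpa [Set.compl_def, Set.Iic] using h0
  rw [key, key, ← mShift_eq_map]

theorem integrableOn_mShift_iff {m : Measure ℝ} (h0 : m (Set.Iic 0) = 0) {u : ℝ} {f : ℝ → ℝ} :
    IntegrableOn f (Set.Ioi 0) (mShift m u)
      ↔ IntegrableOn (fun w => f (w + u)) (Set.Ioi 0) (mShift m (-u)) := by
  rw [IntegrableOn, restrict_Ioi_mShift h0 u]
  exact (MeasurableEquiv.addRight u).measurableEmbedding.integrable_map_iff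

theorem setIntegral_mShift {m : Measure ℝ} (h0 : m (Set.Iic 0) = 0) (u : ℝ) (f : ℝ → ℝ) :
    ∫ z in Set.Ioi (0 : ℝ), f z ∂(mShift m u)
      = ∫ w in Set.Ioi (0 : ℝ), f (w + u) ∂(mShift m (-u)) := by
  rw [restrict_Ioi_mShift h0 u]
  exact (MeasurableEquiv.addRight u).measurableEmbedding.integral_map f

theorem restrict_mShift_neg_le (m : Measure ℝ) (u : ℝ) :
    (mShift m (-u)).restrict (Set.Ioi 0)
      ≤ (2⁻¹ : ENNReal) • Measure.map (fun z => z + -u) (m.restrict (Set.Ioi u)) := by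
  refine (Measure.restrict_mono_measure (mShift_le_map m (-u)) _).trans ?_
  rw [Measure.restrict_smul, Measure.restrict_map (by fun_prop) measurableSet_Ioi]
  have : (fun z : ℝ => z + -u) ⁻¹' Set.Ioi 0 = Set.Ioi u := by ext z; simp
  rw [this]

theorem integrableOn_mShift_neg {m : Measure ℝ} {u : ℝ} {f : ℝ → ℝ}
    (hf : IntegrableOn (fun z => f (z + -u)) (Set.Ioi u) m) :
    IntegrableOn f (Set.Ioi 0) (mShift m (-u)) := by
  refine Integrable.mono_measure ?_ (restrict_mShift_neg_le m u)
  refine Integrable.smul_measure ?_ (by simp)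
  exact ((MeasurableEquiv.addRight (-u)).measurableEmbedding.integrable_map_iff).2 hf

theorem setIntegral_mShift_neg_le {m : Measure ℝ} {u : ℝ} {f : ℝ → ℝ}
    (hpos : ∀ z, 0 < z → 0 ≤ f z)
    (hf : IntegrableOn (fun z => f (z + -u)) (Set.Ioi u) m) :
    2 * ∫ w in Set.Ioi (0 : ℝ), f w ∂(mShift m (-u)) ≤ ∫ z in Set.Ioi u, f (z + -u) ∂m := by
  have hmap : ∫ w, f w ∂(Measure.map (fun z => z + -u) (m.restrict (Set.Ioi u)))
      = ∫ z in Set.Ioi u, f (z + -u) ∂m :=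
    (MeasurableEquiv.addRight (-u)).measurableEmbedding.integral_map f
  have hf_int : Integrable f (Measure.map (fun z => z + -u) (m.restrict (Set.Ioi u))) :=
    ((MeasurableEquiv.addRight (-u)).measurableEmbedding.integrable_map_iff).2 hf
  have hae : 0 ≤ᵐ[Measure.map (fun z => z + -u) (m.restrict (Set.Ioi u))] f := by
    have : ∀ᵐ z ∂(Measure.map (fun z => z + -u) (m.restrict (Set.Ioi u))), 0 < z := by
      rw [ae_map_iff (by fun_prop) measurableSet_Ioi]
      filter_upwards [ae_restrict_mem measurableSet_Ioi] with z hz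
      simpa using hz
    filter_upwards [this] with z hz using hpos z hz
  have := integral_mono_measure (restrict_mShift_neg_le m u)
    (hae.filter_mono (Measure.smul_absolutelyContinuous.ae_le))
    (hf_int.smul_measure (c := (2⁻¹ : ENNReal)) (by simp))
  rw [integral_smul_measure, hmap] at this
  simp at this
  linarith

/-- The `C²` function `(1 - 2x)₊³`, the nonconstant part of `phi0 (1/2) θ`. -/
noncomputable def bump (x : ℝ) : ℝ := (max 0 (1 - 2 * x)) ^ 3

/-- The derivative of `bump`. -/
noncomputable def bumpD (x : ℝ) : ℝ := -6 * (max 0 (1 - 2 * x)) ^ 2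

/-- The second derivative of `bump`. -/
noncomputable def bumpDD (x : ℝ) : ℝ := 24 * max 0 (1 - 2 * x)

theorem hasDerivAt_max_zero_pow (n : ℕ) (t : ℝ) :
    HasDerivAt (fun s : ℝ => (max 0 s) ^ (n + 2)) ((n + 2) * (max 0 t) ^ (n + 1)) t := by
  rcases lt_trichotomy t 0 with ht | rfl | ht
  · have h : (fun s : ℝ => (max 0 s) ^ (n + 2)) =ᶠ[nhds t] fun _ => 0 := by
      filter_upwards [Iio_mem_nhds ht] with s hs
      rw [max_eq_left (le_of_lt hs), zero_pow (by omega)]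
    rw [max_eq_left ht.le, zero_pow (by omega), mul_zero]
    exact (hasDerivAt_const t (0 : ℝ)).congr_of_eventuallyEq h
  · have h : (fun s : ℝ => (max 0 s) ^ (n + 2)) =O[nhds 0] fun s => ‖s - 0‖ ^ (n + 2) := by
      refine Asymptotics.IsBigO.of_bound 1 (Filter.Eventually.of_forall fun s => ?_)
      rw [one_mul, norm_pow, norm_pow, norm_norm, sub_zero]
      gcongr
      rw [Real.norm_eq_abs, Real.norm_eq_abs, abs_of_nonneg (le_max_left _ _)]
      exact max_le (abs_nonneg s) (le_abs_self s)
    simpa using (h.hasFDerivAt (𝕜 := ℝ) (by omega)).hasDerivAt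
  · have h : (fun s : ℝ => (max 0 s) ^ (n + 2)) =ᶠ[nhds t] fun s => s ^ (n + 2) := by
      filter_upwards [Ioi_mem_nhds ht] with s hs
      rw [max_eq_right (le_of_lt hs)]
    rw [max_eq_right ht.le]
    refine HasDerivAt.congr_of_eventuallyEq ?_ h
    refine (hasDerivAt_pow (n + 2) t).congr_deriv ?_
    push_cast
    rfl

theorem hasDerivAt_bump (x : ℝ) : HasDerivAt bump (bumpD x) x := by
  have h := (hasDerivAt_max_zero_pow 1 (1 - 2 * x)).comp x
    (((hasDerivAt_id x).const_mul 2).const_sub 1)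
  refine h.congr_deriv ?_
  rw [bumpD]
  push_cast
  ring

theorem hasDerivAt_bumpD (x : ℝ) : HasDerivAt bumpD (bumpDD x) x := by
  have h := ((hasDerivAt_max_zero_pow 0 (1 - 2 * x)).comp x
    (((hasDerivAt_id x).const_mul 2).const_sub 1)).const_mul (-6)
  refine h.congr_deriv ?_
  rw [bumpDD]
  push_cast
  ring

theorem continuous_bump : Continuous bump := by unfold bump; fun_prop

theorem measurable_cutoff : Measurable cutoff :=
  Measurable.ite measurableSet_Iic measurable_id measurable_const

theorem max_zero_one_sub_mem {x : ℝ} (hx : 0 ≤ x) :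
    0 ≤ max 0 (1 - 2 * x) ∧ max 0 (1 - 2 * x) ≤ 1 :=
  ⟨le_max_left _ _, max_le zero_le_one (by linarith)⟩

theorem bump_nonneg (x : ℝ) : 0 ≤ bump x := by unfold bump; positivity

theorem bump_le_one {x : ℝ} (hx : 0 ≤ x) : bump x ≤ 1 :=
  pow_le_one₀ (max_zero_one_sub_mem hx).1 (max_zero_one_sub_mem hx).2

theorem bump_antitone : Antitone bump := fun x y h => by
  unfold bump
  gcongr

theorem bumpD_nonpos (x : ℝ) : bumpD x ≤ 0 := by
  unfold bumpD
  nlinarith [sq_nonneg (max 0 (1 - 2 * x))]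

theorem neg_six_le_bumpD {x : ℝ} (hx : 0 ≤ x) : -6 ≤ bumpD x := by
  unfold bumpD
  have := pow_le_one₀ (n := 2) (max_zero_one_sub_mem hx).1 (max_zero_one_sub_mem hx).2
  linarith

theorem bumpDD_nonneg (x : ℝ) : 0 ≤ bumpDD x := by unfold bumpDD; positivity

theorem bumpDD_le {x : ℝ} (hx : 0 ≤ x) : bumpDD x ≤ 24 := by
  unfold bumpDD
  linarith [(max_zero_one_sub_mem hx).2]

theorem bump_eq_zero {x : ℝ} (hx : 1 / 2 ≤ x) : bump x = 0 ∧ bumpD x = 0 ∧ bumpDD x = 0 := by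
  have : max 0 (1 - 2 * x) = 0 := max_eq_left (by linarith)
  simp [bump, bumpD, bumpDD, this]

theorem abs_bump_add_sub_le {x z : ℝ} (hx : 0 ≤ x) (hz : 0 < z) :
    |bump (x + z) - bump x| ≤ 6 * min 1 z := by
  have h1 := bump_antitone (show x ≤ x + z by linarith)
  have h2 := bump_nonneg (x + z)
  have h3 := bump_le_one hx
  rw [abs_of_nonpos (by linarith), mul_min_of_nonneg _ _ (by norm_num)]
  refine le_min (by linarith) ?_
  unfold bump
  obtain ⟨ht0, ht1⟩ := max_zero_one_sub_mem hx
  obtain ⟨hs0, hs1⟩ := max_zero_one_sub_mem (show 0 ≤ x + z by linarith)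
  have hst : max 0 (1 - 2 * x) - 2 * z ≤ max 0 (1 - 2 * (x + z)) := by
    rcases max_cases 0 (1 - 2 * x) with h | h
    · linarith
    · linarith [le_max_right 0 (1 - 2 * (x + z))]
  have hts : max 0 (1 - 2 * (x + z)) ≤ max 0 (1 - 2 * x) := max_le_max_left _ (by linarith)
  generalize max 0 (1 - 2 * x) = t at *
  generalize max 0 (1 - 2 * (x + z)) = s at *
  have : -(s ^ 3 - t ^ 3) = (t - s) * (t ^ 2 + t * s + s ^ 2) := by ring
  rw [this]
  have h4 : t ^ 2 + t * s + s ^ 2 ≤ 3 := by nlinarith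
  nlinarith

theorem bump_add_sub_le {x z : ℝ} (hx' : x ≤ 1 / 4) (hz : 0 < z) :
    bump (x + z) - bump x ≤ -(1 / 8 * min 1 z) := by
  unfold bump
  have ht : max 0 (1 - 2 * x) = 1 - 2 * x := max_eq_right (by linarith)
  rw [ht]
  set t := 1 - 2 * x with htd
  have ht2 : 1 / 2 ≤ t := by rw [htd]; linarith
  set s := max 0 (1 - 2 * (x + z)) with hs
  have hs0 : 0 ≤ s := le_max_left _ _
  have key : s ≤ t - 1 / 2 * min 1 z := by
    apply max_le
    · linarith [min_le_left 1 z]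
    · linarith [min_le_right 1 z]
  have hm : 0 < min 1 z := lt_min one_pos hz
  have : t ^ 3 - s ^ 3 = (t - s) * (t ^ 2 + t * s + s ^ 2) := by ring
  have h4 : 1 / 4 ≤ t ^ 2 + t * s + s ^ 2 := by nlinarith
  nlinarith

theorem abs_bump_taylor_le {x z : ℝ} (hx : 0 ≤ x) (hz : 0 < z) :
    |bump (x + z) - bump x - bumpD x * cutoff z| ≤ 24 * min 1 (z ^ 2) := by
  by_cases h1 : z ≤ 1
  · rw [cutoff, if_pos h1, min_eq_right (by nlinarith)]
    unfold bump bumpD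
    obtain ⟨ht0, ht1⟩ := max_zero_one_sub_mem hx
    obtain ⟨hs0, hs1⟩ := max_zero_one_sub_mem (show 0 ≤ x + z by linarith)
    have hs : max 0 (1 - 2 * (x + z)) = max 0 (max 0 (1 - 2 * x) - 2 * z) := by
      rcases max_cases 0 (1 - 2 * x) with h | h
      · rw [h.1, max_eq_left (by linarith), max_eq_left (by linarith)]
      · rw [h.1]; congr 1; ring
    rw [hs]
    generalize max 0 (1 - 2 * x) = t at *
    rcases max_cases 0 (t - 2 * z) with h | h
    · rw [h.1, abs_le]
      have h2 : t ^ 2 ≤ 4 * z ^ 2 := by nlinarith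
      constructor
      · nlinarith [mul_nonneg (sq_nonneg t) hz.le, mul_nonneg (sq_nonneg t) (sub_nonneg.2 h.2)]
      · have : t ^ 2 * z ≤ 4 * z ^ 2 * 1 := by gcongr
        nlinarith [pow_nonneg ht0 3]
    · rw [h.1, abs_le]
      have : (t - 2 * z) ^ 3 - t ^ 3 - -6 * t ^ 2 * z = z ^ 2 * (4 * (2 * t + (t - 2 * z))) := by
        ring
      rw [this]
      constructor <;> nlinarith [sq_nonneg z]
  · push Not at h1
    rw [cutoff, if_neg (by linarith), min_eq_left (by nlinarith), mul_zero, sub_zero]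
    have := abs_bump_add_sub_le hx hz
    rw [min_eq_left h1.le] at this
    linarith

theorem one_sub_exp_neg_nonneg {l z : ℝ} (hl : 0 < l) (hz : 0 < z) :
    0 ≤ 1 - Real.exp (-(l * z)) := by
  have : Real.exp (-(l * z)) ≤ 1 := Real.exp_le_one_iff.2 (by nlinarith [mul_pos hl hz])
  linarith

theorem one_sub_exp_neg_le {l z : ℝ} (hl : 0 < l) (hz : 0 < z) :
    1 - Real.exp (-(l * z)) ≤ (l + 1) * min 1 z := by
  rw [mul_min_of_nonneg _ _ (by linarith)]
  refine le_min ?_ ?_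
  · linarith [Real.exp_pos (-(l * z))]
  · linarith [Real.add_one_le_exp (-(l * z))]

theorem abs_exp_neg_taylor_le {l z : ℝ} (hl : 0 < l) (hz : 0 < z) :
    |Real.exp (-(l * z)) - 1 + l * cutoff z| ≤ (l ^ 2 + 1) * min 1 (z ^ 2) := by
  have ha := mul_pos hl hz
  by_cases h1 : z ≤ 1
  · rw [cutoff, if_pos h1, min_eq_right (by nlinarith)]
    have h2 := Real.add_one_le_exp (-(l * z))
    have h3 : Real.exp (-(l * z)) ≤ 1 - l * z + (l * z) ^ 2 := by
      rw [Real.exp_neg, inv_le_iff_one_le_mul₀ (Real.exp_pos _)]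
      have := Real.add_one_le_exp (l * z)
      have h4 : 0 ≤ 1 - l * z + (l * z) ^ 2 := by nlinarith [sq_nonneg (l * z - 1)]
      nlinarith [pow_pos ha 3]
    rw [abs_of_nonneg (by linarith)]
    nlinarith [sq_nonneg z]
  · push Not at h1
    rw [cutoff, if_neg (by linarith), min_eq_left (by nlinarith), mul_zero, add_zero, mul_one,
      abs_of_nonpos (by linarith [one_sub_exp_neg_nonneg hl hz])]
    nlinarith [Real.exp_pos (-(l * z)), sq_nonneg l]

theorem exists_taylor_bound {V : ℝ → ℝ} (hV : ContDiff ℝ 2 V) (R : ℝ) :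
    ∃ M : ℝ, 0 ≤ M ∧ ∀ y, 0 ≤ y → y ≤ R →
      |V y| ≤ M ∧ |deriv V y| ≤ M ∧ |deriv (deriv V) y| ≤ M ∧
      ∀ z, 0 < z → z ≤ 1 → |V (y + z) - V y| ≤ M * z ∧
        |V (y + z) - V y - deriv V y * z| ≤ M * z ^ 2 := by
  have hV0 : Differentiable ℝ V := hV.differentiable (by norm_num)
  have hV' : ContDiff ℝ 1 (deriv V) := hV.deriv' (n := 1)
  have hV1 : Differentiable ℝ (deriv V) := hV'.differentiable (by norm_num)
  have hV2 : Continuous (deriv (deriv V)) := hV'.continuous_deriv (by norm_num)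
  obtain ⟨M0, h0⟩ := isCompact_Icc.exists_bound_of_continuousOn (s := Set.Icc 0 (R + 1))
    hV0.continuous.continuousOn
  obtain ⟨M1, h1⟩ := isCompact_Icc.exists_bound_of_continuousOn (s := Set.Icc 0 (R + 1))
    hV1.continuous.continuousOn
  obtain ⟨M2, h2⟩ := isCompact_Icc.exists_bound_of_continuousOn (s := Set.Icc 0 (R + 1))
    hV2.continuousOn
  set M := max 0 (max M0 (max M1 M2)) with hM
  have hM0 : M0 ≤ M := by simp [hM]
  have hM1 : M1 ≤ M := by simp [hM]
  have hM2 : M2 ≤ M := by simp [hM]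
  refine ⟨M, le_max_left _ _, fun y hy hyR => ⟨?_, ?_, ?_, fun z hz hz1 => ?_⟩⟩
  · exact (h0 y ⟨hy, by linarith⟩).trans hM0
  · exact (h1 y ⟨hy, by linarith⟩).trans hM1
  · exact (h2 y ⟨hy, by linarith⟩).trans hM2
  · obtain ⟨ξ, ⟨hξ0, hξ1⟩, hξ⟩ := exists_deriv_eq_slope V (show y < y + z by linarith)
      hV0.continuous.continuousOn hV0.differentiableOn
    rw [add_sub_cancel_left, eq_div_iff hz.ne'] at hξ
    have hb1 : |deriv V ξ| ≤ M := (h1 ξ ⟨by linarith, by linarith⟩).trans hM1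
    obtain ⟨ζ, ⟨hζ0, hζ1⟩, hζ⟩ := exists_deriv_eq_slope (deriv V) hξ0
      hV1.continuous.continuousOn hV1.differentiableOn
    rw [eq_div_iff (by linarith)] at hζ
    have hb2 : |deriv (deriv V) ζ| ≤ M := (h2 ζ ⟨by linarith, by linarith⟩).trans hM2
    constructor
    · rw [← hξ, abs_mul, abs_of_pos hz]
      gcongr
    · rw [← hξ, ← sub_mul, ← hζ, abs_mul, abs_mul, abs_of_pos hz,
        abs_of_pos (show 0 < ξ - y by linarith), sq, ← mul_assoc]
      gcongr
      linarith

theorem phi0_half (θ x : ℝ) : phi0 (1 / 2) θ x = θ + bump x := by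
  unfold phi0 bump
  split_ifs with h
  · rw [max_eq_right (by linarith)]
    ring
  · rw [max_eq_left (by linarith)]
    ring

theorem G0_of_lt (lam0 θ ε : ℝ) (V : ℝ → ℝ) {x y : ℝ} (h : y < x) :
    G0 lam0 (1 / 2) θ ε V x y
      = ε * ((θ + bump x) * (2 - Real.exp (-(lam0 * (x - y))))) + (V x + V y) := by
  rw [G0, F0, if_neg h.ne', if_neg h.ne', phi0_half, psi0]
  ring

theorem G0_self (lam0 θ ε : ℝ) (V : ℝ → ℝ) (x : ℝ) : G0 lam0 (1 / 2) θ ε V x x = 0 := by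
  simp [G0, F0]

section PartialDerivatives

variable (lam0 θ ε : ℝ) {V : ℝ → ℝ}

theorem hasDerivAt_exp_fst (y x : ℝ) :
    HasDerivAt (fun t => Real.exp (-(lam0 * (t - y))))
      (-(lam0 * Real.exp (-(lam0 * (x - y))))) x := by
  refine ((((hasDerivAt_id' x).sub_const y).const_mul lam0).fun_neg).exp.congr_deriv ?_
  ring

theorem hasDerivAt_exp_snd (x y : ℝ) :
    HasDerivAt (fun t => Real.exp (-(lam0 * (x - t))))
      (lam0 * Real.exp (-(lam0 * (x - y)))) y := by
  refine ((((hasDerivAt_id' y).const_sub x).const_mul lam0).fun_neg).exp.congr_deriv ?_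
  ring

theorem Fx_G0 (hV : Differentiable ℝ V) {x y : ℝ} (h : y < x) :
    Fx (G0 lam0 (1 / 2) θ ε V) x y
      = ε * (bumpD x * (2 - Real.exp (-(lam0 * (x - y))))
          + (θ + bump x) * (lam0 * Real.exp (-(lam0 * (x - y))))) + deriv V x := by
  have he : (fun t => G0 lam0 (1 / 2) θ ε V t y) =ᶠ[nhds x] fun t =>
      ε * ((θ + bump t) * (2 - Real.exp (-(lam0 * (t - y))))) + (V t + V y) := by
    filter_upwards [Ioi_mem_nhds h] with t ht using G0_of_lt lam0 θ ε V ht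
  rw [Fx, he.deriv_eq]
  refine (((((hasDerivAt_bump x).const_add θ).mul
    ((hasDerivAt_exp_fst lam0 y x).const_sub 2)).const_mul ε).add
    ((hV x).hasDerivAt.add_const (V y))).deriv.trans ?_
  ring

theorem Fy_G0 (hV : Differentiable ℝ V) {x y : ℝ} (h : y < x) :
    Fy (G0 lam0 (1 / 2) θ ε V) x y
      = ε * ((θ + bump x) * (-(lam0 * Real.exp (-(lam0 * (x - y)))))) + deriv V y := by
  have he : (fun t => G0 lam0 (1 / 2) θ ε V x t) =ᶠ[nhds y] fun t =>
      ε * ((θ + bump x) * (2 - Real.exp (-(lam0 * (x - t))))) + (V x + V t) := by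
    filter_upwards [Iio_mem_nhds h] with t ht using G0_of_lt lam0 θ ε V ht
  rw [Fy, he.deriv_eq]
  refine (((((hasDerivAt_exp_snd lam0 x y).const_sub 2).const_mul (θ + bump x)).const_mul ε).add
    ((hV y).hasDerivAt.const_add (V x))).deriv.trans ?_
  ring

theorem Fxx_G0 (hV : Differentiable ℝ V) (hV' : Differentiable ℝ (deriv V)) {x y : ℝ}
    (h : y < x) :
    Fxx (G0 lam0 (1 / 2) θ ε V) x y
      = ε * (bumpDD x * (2 - Real.exp (-(lam0 * (x - y))))
          + 2 * bumpD x * (lam0 * Real.exp (-(lam0 * (x - y))))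
          - (θ + bump x) * (lam0 ^ 2 * Real.exp (-(lam0 * (x - y))))) + deriv (deriv V) x := by
  have he : (fun t => Fx (G0 lam0 (1 / 2) θ ε V) t y) =ᶠ[nhds x] fun t =>
      ε * (bumpD t * (2 - Real.exp (-(lam0 * (t - y))))
          + (θ + bump t) * (lam0 * Real.exp (-(lam0 * (t - y))))) + deriv V t := by
    filter_upwards [Ioi_mem_nhds h] with t ht using Fx_G0 lam0 θ ε hV ht
  rw [Fxx, he.deriv_eq]
  refine ((((hasDerivAt_bumpD x).mul ((hasDerivAt_exp_fst lam0 y x).const_sub 2)).add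
    (((hasDerivAt_bump x).const_add θ).mul
      ((hasDerivAt_exp_fst lam0 y x).const_mul lam0))).const_mul ε |>.add
    (hV' x).hasDerivAt).deriv.trans ?_
  ring

theorem Fyy_G0 (hV : Differentiable ℝ V) (hV' : Differentiable ℝ (deriv V)) {x y : ℝ}
    (h : y < x) :
    Fyy (G0 lam0 (1 / 2) θ ε V) x y
      = -(ε * ((θ + bump x) * (lam0 ^ 2 * Real.exp (-(lam0 * (x - y))))))
          + deriv (deriv V) y := by
  have he : (fun t => Fy (G0 lam0 (1 / 2) θ ε V) x t) =ᶠ[nhds y] fun t =>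
      ε * ((θ + bump x) * (-(lam0 * Real.exp (-(lam0 * (x - t)))))) + deriv V t := by
    filter_upwards [Iio_mem_nhds h] with t ht using Fy_G0 lam0 θ ε hV ht
  rw [Fyy, he.deriv_eq]
  refine ((((hasDerivAt_exp_snd lam0 x y).const_mul lam0).neg.const_mul
    (θ + bump x)).const_mul ε |>.add (hV' y).hasDerivAt).deriv.trans ?_
  ring

theorem Fxy_G0 (hV : Differentiable ℝ V) {x y : ℝ} (h : y < x) :
    Fxy (G0 lam0 (1 / 2) θ ε V) x y
      = ε * (-(bumpD x * (lam0 * Real.exp (-(lam0 * (x - y)))))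
          + (θ + bump x) * (lam0 ^ 2 * Real.exp (-(lam0 * (x - y))))) := by
  have he : (fun t => Fx (G0 lam0 (1 / 2) θ ε V) x t) =ᶠ[nhds y] fun t =>
      ε * (bumpD x * (2 - Real.exp (-(lam0 * (x - t))))
          + (θ + bump x) * (lam0 * Real.exp (-(lam0 * (x - t))))) + deriv V x := by
    filter_upwards [Iio_mem_nhds h] with t ht using Fx_G0 lam0 θ ε hV ht
  rw [Fxy, he.deriv_eq]
  refine (((((hasDerivAt_exp_snd lam0 x y).const_sub 2).const_mul (bumpD x)).add
    (((hasDerivAt_exp_snd lam0 x y).const_mul lam0).const_mul (θ + bump x))).const_mul ε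
    |>.add_const (deriv V x)).deriv.trans ?_
  ring

end PartialDerivatives

section JumpIntegrals

variable {lam0 θ ε : ℝ} {V : ℝ → ℝ} {m : Measure ℝ} {x y : ℝ}

theorem integrableOn_bump_sub (hm : IntegrableOn (fun z : ℝ => min 1 z) (Set.Ioi 0) m)
    (hx : 0 ≤ x) : IntegrableOn (fun z => bump (x + z) - bump x) (Set.Ioi 0) m :=
  integrableOn_Ioi_of_abs_le hm
    ((continuous_bump.measurable.comp (measurable_const_add x)).sub_const _)
    fun _ hz => abs_bump_add_sub_le hx hz

theorem integrableOn_bump_taylor (hm : IntegrableOn (fun z : ℝ => min 1 (z ^ 2)) (Set.Ioi 0) m)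
    (hx : 0 ≤ x) :
    IntegrableOn (fun z => bump (x + z) - bump x - bumpD x * cutoff z) (Set.Ioi 0) m :=
  integrableOn_Ioi_of_abs_le hm
    (((continuous_bump.measurable.comp (measurable_const_add x)).sub_const _).sub
      (measurable_cutoff.const_mul _))
    fun _ hz => abs_bump_taylor_le hx hz

theorem integrableOn_exp_taylor (hm : IntegrableOn (fun z : ℝ => min 1 (z ^ 2)) (Set.Ioi 0) m)
    (hl : 0 < lam0) :
    IntegrableOn (fun z => Real.exp (-(lam0 * z)) - 1 + lam0 * cutoff z) (Set.Ioi 0) m :=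
  integrableOn_Ioi_of_abs_le hm
    (((by fun_prop : Measurable fun z => Real.exp (-(lam0 * z))).sub_const _).add
      (measurable_cutoff.const_mul _))
    fun _ hz => abs_exp_neg_taylor_le hl hz

theorem abs_bump_sub_mul_le (hl : 0 < lam0) (hx : 0 ≤ x) {z : ℝ} (hz : 0 < z) :
    |(bump (x + z) - bump x) * (1 - Real.exp (-(lam0 * z)))|
      ≤ (6 * (lam0 + 1)) * min 1 (z ^ 2) := by
  have hmin : min 1 (z ^ 2) = min 1 z * min 1 z := by
    rcases le_total z 1 with h | h
    · rw [min_eq_right h, min_eq_right (by nlinarith), sq]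
    · rw [min_eq_left h, min_eq_left (by nlinarith), one_mul]
  rw [abs_mul, abs_of_nonneg (one_sub_exp_neg_nonneg hl hz), hmin]
  calc _ ≤ (6 * min 1 z) * ((lam0 + 1) * min 1 z) :=
        mul_le_mul (abs_bump_add_sub_le hx hz) (one_sub_exp_neg_le hl hz)
          (one_sub_exp_neg_nonneg hl hz) (by positivity)
    _ = _ := by ring

theorem integrableOn_bump_sub_mul
    (hm : IntegrableOn (fun z : ℝ => min 1 (z ^ 2)) (Set.Ioi 0) m)
    (hl : 0 < lam0) (hx : 0 ≤ x) :
    IntegrableOn (fun z => (bump (x + z) - bump x) * (1 - Real.exp (-(lam0 * z))))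
      (Set.Ioi 0) m :=
  integrableOn_Ioi_of_abs_le hm
    (((continuous_bump.measurable.comp (measurable_const_add x)).sub_const _).mul (by fun_prop))
    fun _ hz => abs_bump_sub_mul_le hl hx hz

theorem G0_immigration_jump
    (hm : IntegrableOn (fun z : ℝ => min 1 z) (Set.Ioi 0) m) (hy : 0 ≤ y) (hxy : y < x)
    (hVx : IntegrableOn (fun z => V (x + z) - V x) (Set.Ioi 0) m)
    (hVy : IntegrableOn (fun z => V (y + z) - V y) (Set.Ioi 0) m) :
    IntegrableOn (fun z => G0 lam0 (1 / 2) θ ε V (x + z) (y + z) - G0 lam0 (1 / 2) θ ε V x y)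
      (Set.Ioi 0) m ∧
    ∫ z in Set.Ioi (0 : ℝ), (G0 lam0 (1 / 2) θ ε V (x + z) (y + z)
        - G0 lam0 (1 / 2) θ ε V x y) ∂m
      = ε * (2 - Real.exp (-(lam0 * (x - y))))
          * (∫ z in Set.Ioi (0 : ℝ), (bump (x + z) - bump x) ∂m)
        + (∫ z in Set.Ioi (0 : ℝ), (V (x + z) - V x) ∂m)
        + ∫ z in Set.Ioi (0 : ℝ), (V (y + z) - V y) ∂m := by
  have hB := (integrableOn_bump_sub hm (hy.trans hxy.le)).const_mul
    (ε * (2 - Real.exp (-(lam0 * (x - y)))))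
  have heq : (fun z => G0 lam0 (1 / 2) θ ε V (x + z) (y + z) - G0 lam0 (1 / 2) θ ε V x y)
      = fun z => ε * (2 - Real.exp (-(lam0 * (x - y)))) * (bump (x + z) - bump x)
        + (V (x + z) - V x) + (V (y + z) - V y) := by
    ext z
    rw [G0_of_lt _ _ _ _ hxy, G0_of_lt _ _ _ _ (show y + z < x + z by linarith),
      add_sub_add_right_eq_sub]
    ring
  rw [heq]
  refine ⟨(hB.add hVx).add hVy, ?_⟩
  rw [integral_add (hB.fun_add hVx) hVy, integral_add hB hVx, integral_const_mul]

theorem G0_common_branching_jump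
    (hm : IntegrableOn (fun z : ℝ => min 1 (z ^ 2)) (Set.Ioi 0) m)
    (hVd : Differentiable ℝ V) (hy : 0 ≤ y) (hxy : y < x)
    (hVx : IntegrableOn (fun z => V (x + z) - V x - deriv V x * cutoff z) (Set.Ioi 0) m)
    (hVy : IntegrableOn (fun z => V (y + z) - V y - deriv V y * cutoff z) (Set.Ioi 0) m) :
    IntegrableOn (fun z => G0 lam0 (1 / 2) θ ε V (x + z) (y + z) - G0 lam0 (1 / 2) θ ε V x y
      - (Fx (G0 lam0 (1 / 2) θ ε V) x y + Fy (G0 lam0 (1 / 2) θ ε V) x y) * cutoff z)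
      (Set.Ioi 0) m ∧
    ∫ z in Set.Ioi (0 : ℝ), (G0 lam0 (1 / 2) θ ε V (x + z) (y + z)
        - G0 lam0 (1 / 2) θ ε V x y
        - (Fx (G0 lam0 (1 / 2) θ ε V) x y + Fy (G0 lam0 (1 / 2) θ ε V) x y) * cutoff z) ∂m
      = ε * (2 - Real.exp (-(lam0 * (x - y))))
          * (∫ z in Set.Ioi (0 : ℝ), (bump (x + z) - bump x - bumpD x * cutoff z) ∂m)
        + (∫ z in Set.Ioi (0 : ℝ), (V (x + z) - V x - deriv V x * cutoff z) ∂m)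
        + ∫ z in Set.Ioi (0 : ℝ), (V (y + z) - V y - deriv V y * cutoff z) ∂m := by
  have hB := (integrableOn_bump_taylor hm (hy.trans hxy.le)).const_mul
    (ε * (2 - Real.exp (-(lam0 * (x - y)))))
  have heq : (fun z => G0 lam0 (1 / 2) θ ε V (x + z) (y + z) - G0 lam0 (1 / 2) θ ε V x y
      - (Fx (G0 lam0 (1 / 2) θ ε V) x y + Fy (G0 lam0 (1 / 2) θ ε V) x y) * cutoff z)
      = fun z => ε * (2 - Real.exp (-(lam0 * (x - y))))
          * (bump (x + z) - bump x - bumpD x * cutoff z)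
        + (V (x + z) - V x - deriv V x * cutoff z)
        + (V (y + z) - V y - deriv V y * cutoff z) := by
    ext z
    rw [G0_of_lt _ _ _ _ hxy, G0_of_lt _ _ _ _ (show y + z < x + z by linarith),
      add_sub_add_right_eq_sub, Fx_G0 _ _ _ hVd hxy, Fy_G0 _ _ _ hVd hxy]
    ring
  rw [heq]
  refine ⟨(hB.add hVx).add hVy, ?_⟩
  rw [integral_add (hB.fun_add hVx) hVy, integral_add hB hVx, integral_const_mul]

theorem G0_single_branching_jump
    (hm : IntegrableOn (fun z : ℝ => min 1 (z ^ 2)) (Set.Ioi 0) m) (hl : 0 < lam0)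
    (hVd : Differentiable ℝ V) (hy : 0 ≤ y) (hxy : y < x)
    (hVx : IntegrableOn (fun z => V (x + z) - V x - deriv V x * cutoff z) (Set.Ioi 0) m) :
    IntegrableOn (fun z => G0 lam0 (1 / 2) θ ε V (x + z) y - G0 lam0 (1 / 2) θ ε V x y
      - Fx (G0 lam0 (1 / 2) θ ε V) x y * cutoff z) (Set.Ioi 0) m ∧
    ∫ z in Set.Ioi (0 : ℝ), (G0 lam0 (1 / 2) θ ε V (x + z) y - G0 lam0 (1 / 2) θ ε V x y
        - Fx (G0 lam0 (1 / 2) θ ε V) x y * cutoff z) ∂m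
      = ε * (2 - Real.exp (-(lam0 * (x - y))))
          * (∫ z in Set.Ioi (0 : ℝ), (bump (x + z) - bump x - bumpD x * cutoff z) ∂m)
        + -(ε * (θ + bump x) * Real.exp (-(lam0 * (x - y))))
          * (∫ z in Set.Ioi (0 : ℝ), (Real.exp (-(lam0 * z)) - 1 + lam0 * cutoff z) ∂m)
        + ε * Real.exp (-(lam0 * (x - y)))
          * (∫ z in Set.Ioi (0 : ℝ), (bump (x + z) - bump x) * (1 - Real.exp (-(lam0 * z))) ∂m)
        + ∫ z in Set.Ioi (0 : ℝ), (V (x + z) - V x - deriv V x * cutoff z) ∂m := by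
  have hB := (integrableOn_bump_taylor hm (hy.trans hxy.le)).const_mul
    (ε * (2 - Real.exp (-(lam0 * (x - y)))))
  have hE := (integrableOn_exp_taylor hm hl).const_mul
    (-(ε * (θ + bump x) * Real.exp (-(lam0 * (x - y)))))
  have hJ := (integrableOn_bump_sub_mul hm hl (hy.trans hxy.le)).const_mul
    (ε * Real.exp (-(lam0 * (x - y))))
  have heq : Set.EqOn
      (fun z => ε * (2 - Real.exp (-(lam0 * (x - y))))
          * (bump (x + z) - bump x - bumpD x * cutoff z)
        + -(ε * (θ + bump x) * Real.exp (-(lam0 * (x - y))))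
          * (Real.exp (-(lam0 * z)) - 1 + lam0 * cutoff z)
        + ε * Real.exp (-(lam0 * (x - y)))
          * ((bump (x + z) - bump x) * (1 - Real.exp (-(lam0 * z))))
        + (V (x + z) - V x - deriv V x * cutoff z))
      (fun z => G0 lam0 (1 / 2) θ ε V (x + z) y - G0 lam0 (1 / 2) θ ε V x y
        - Fx (G0 lam0 (1 / 2) θ ε V) x y * cutoff z) (Set.Ioi 0) := by
    intro z hz
    have hz0 : 0 < z := hz
    have hexp : Real.exp (-(lam0 * (x + z - y)))
        = Real.exp (-(lam0 * (x - y))) * Real.exp (-(lam0 * z)) := by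
      rw [← Real.exp_add]; congr 1; ring
    simp only
    rw [G0_of_lt _ _ _ _ hxy, G0_of_lt _ _ _ _ (show y < x + z by linarith),
      Fx_G0 _ _ _ hVd hxy, hexp]
    ring
  refine ⟨IntegrableOn.congr_fun (((hB.add hE).add hJ).add hVx) heq measurableSet_Ioi, ?_⟩
  rw [← setIntegral_congr_fun measurableSet_Ioi heq, integral_add ((hB.fun_add hE).fun_add hJ) hVx,
    integral_add (hB.fun_add hE) hJ, integral_add hB hE, integral_const_mul, integral_const_mul,
    integral_const_mul]

end JumpIntegrals

section Lasso

/-- The contribution of the measure `m` to `Ltil1` for `G0`, after both lassoing integrals have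
been transported to the measure `mShift m (y - x)`. -/
noncomputable def lasso (lam0 θ ε : ℝ) (V : ℝ → ℝ) (m : Measure ℝ) (x y : ℝ) : ℝ :=
  ∫ w in Set.Ioi (0 : ℝ), (ε * ((θ + bump (x + w + (x - y)))
      * (Real.exp (-(lam0 * (x - y))) - Real.exp (-(lam0 * (x - y))) ^ 2)
      - (θ + bump (x + w)) * (2 - Real.exp (-(lam0 * (x - y))))) - 2 * V (x + w))
    ∂(mShift m (y - x))

variable {lam0 θ ε : ℝ} {V : ℝ → ℝ} {m : Measure ℝ} {x y : ℝ}

theorem integrableOn_add_mShift (hfin : ∀ δ > 0, m (Set.Ioi δ) < ⊤) (hVc : Continuous V)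
    (hxy : y < x) (hV : ∀ δ > 0, IntegrableOn (fun z => V (y + z)) (Set.Ioi δ) m) :
    IntegrableOn (fun w => V (x + w)) (Set.Ioi 0) (mShift m (y - x)) ∧
    IntegrableOn (fun w => V (y + w)) (Set.Ioi 0) (mShift m (y - x)) := by
  have hneg : y - x = -(x - y) := by ring
  rw [hneg]
  constructor
  · refine integrableOn_mShift_neg ?_
    convert hV (x - y) (by linarith) using 3
    ring
  · rw [← Set.Ioc_union_Ioi_eq_Ioi zero_le_one, integrableOn_union]
    constructor
    · have hlt : mShift m (-(x - y)) (Set.Ioc 0 1) < ⊤ :=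
        (measure_mono Set.Ioc_subset_Ioi_self).trans_lt
          (mShift_neg_Ioi_lt_top (hfin (x - y) (by linarith)))
      obtain ⟨C, hC⟩ := isCompact_Icc.exists_bound_of_continuousOn (s := Set.Icc (0 : ℝ) 1)
        (f := fun w => V (y + w)) (by fun_prop)
      refine Measure.integrableOn_of_bounded (M := C) hlt.ne
        (by fun_prop : Continuous fun w => V (y + w)).aestronglyMeasurable ?_
      filter_upwards [ae_restrict_mem measurableSet_Ioc] with w hw
      exact hC w ⟨hw.1.le, hw.2⟩
    · exact (hV 1 one_pos).mono_measure (mShift_le_self m _)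

theorem integrableOn_bump_mShift (hfin : ∀ δ > 0, m (Set.Ioi δ) < ⊤) (hx : 0 ≤ x) (hxy : y < x)
    (a : ℝ) (ha : 0 ≤ a) :
    IntegrableOn (fun w => θ + bump (x + w + a)) (Set.Ioi 0) (mShift m (y - x)) := by
  have hneg : y - x = -(x - y) := by ring
  refine Measure.integrableOn_of_bounded (M := |θ| + 1)
    (hneg ▸ mShift_neg_Ioi_lt_top (hfin (x - y) (by linarith))).ne
    (continuous_const.add (continuous_bump.comp (by fun_prop))).aestronglyMeasurable ?_
  filter_upwards [ae_restrict_mem measurableSet_Ioi] with w hw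
  have hw0 : 0 < w := hw
  refine (norm_add_le _ _).trans ?_
  rw [Real.norm_eq_abs, Real.norm_eq_abs, abs_of_nonneg (bump_nonneg _)]
  gcongr
  exact bump_le_one (by linarith)

theorem integrableOn_lasso (hfin : ∀ δ > 0, m (Set.Ioi δ) < ⊤) (hVc : Continuous V)
    (hy : 0 ≤ y) (hxy : y < x)
    (hV : ∀ δ > 0, IntegrableOn (fun z => V (y + z)) (Set.Ioi δ) m) :
    IntegrableOn (fun w => ε * ((θ + bump (x + w + (x - y)))
      * (Real.exp (-(lam0 * (x - y))) - Real.exp (-(lam0 * (x - y))) ^ 2)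
      - (θ + bump (x + w)) * (2 - Real.exp (-(lam0 * (x - y))))) - 2 * V (x + w))
      (Set.Ioi 0) (mShift m (y - x)) := by
  have hx : 0 ≤ x := hy.trans hxy.le
  have h1 := integrableOn_bump_mShift (θ := θ) hfin hx hxy (x - y) (by linarith)
  have h2 := integrableOn_bump_mShift (θ := θ) hfin hx hxy 0 le_rfl
  simp only [add_zero] at h2
  exact (((h1.mul_const _).sub (h2.mul_const _)).const_mul ε).sub
    ((integrableOn_add_mShift hfin hVc hxy hV).1.const_mul 2)

theorem G0_lasso_jump (h0 : m (Set.Iic 0) = 0) (hfin : ∀ δ > 0, m (Set.Ioi δ) < ⊤)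
    (hVc : Continuous V) (hy : 0 ≤ y) (hxy : y < x)
    (hV : ∀ δ > 0, IntegrableOn (fun z => V (y + z)) (Set.Ioi δ) m) :
    IntegrableOn (fun z => G0 lam0 (1 / 2) θ ε V (x + z) (2 * y + z - x)
      - G0 lam0 (1 / 2) θ ε V (x + z) (y + z)) (Set.Ioi 0) (mShift m (x - y)) ∧
    IntegrableOn (fun z => G0 lam0 (1 / 2) θ ε V (x + z) (x + z)
      - G0 lam0 (1 / 2) θ ε V (x + z) (y + z)) (Set.Ioi 0) (mShift m (y - x)) ∧
    (∫ z in Set.Ioi (0 : ℝ), (G0 lam0 (1 / 2) θ ε V (x + z) (2 * y + z - x)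
        - G0 lam0 (1 / 2) θ ε V (x + z) (y + z)) ∂(mShift m (x - y)))
      + (∫ z in Set.Ioi (0 : ℝ), (G0 lam0 (1 / 2) θ ε V (x + z) (x + z)
        - G0 lam0 (1 / 2) θ ε V (x + z) (y + z)) ∂(mShift m (y - x)))
      = lasso lam0 θ ε V m x y := by
  have hx : 0 ≤ x := hy.trans hxy.le
  have h1 := integrableOn_bump_mShift (θ := θ) hfin hx hxy (x - y) (by linarith)
  have h2 := integrableOn_bump_mShift (θ := θ) hfin hx hxy 0 le_rfl
  simp only [add_zero] at h2
  obtain ⟨hVx, hVy⟩ := integrableOn_add_mShift hfin hVc hxy hV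
  set e := Real.exp (-(lam0 * (x - y))) with he
  have hee : Real.exp (-(lam0 * (2 * (x - y)))) = e ^ 2 := by
    rw [he, ← Real.exp_nat_mul]; congr 1; push_cast; ring
  have hf : (fun w => G0 lam0 (1 / 2) θ ε V (x + (w + (x - y))) (2 * y + (w + (x - y)) - x)
      - G0 lam0 (1 / 2) θ ε V (x + (w + (x - y))) (y + (w + (x - y))))
      = fun w => ε * ((θ + bump (x + w + (x - y))) * (e - e ^ 2)) + (V (y + w) - V (x + w)) := by
    ext w
    rw [G0_of_lt _ _ _ _ (by linarith), G0_of_lt _ _ _ _ (by linarith),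
      show x + (w + (x - y)) - (2 * y + (w + (x - y)) - x) = 2 * (x - y) by ring, hee,
      show x + (w + (x - y)) - (y + (w + (x - y))) = x - y by ring, ← he,
      show x + (w + (x - y)) = x + w + (x - y) by ring,
      show 2 * y + (w + (x - y)) - x = y + w by ring,
      show y + (w + (x - y)) = x + w by ring]
    ring
  have hg : (fun z => G0 lam0 (1 / 2) θ ε V (x + z) (x + z)
      - G0 lam0 (1 / 2) θ ε V (x + z) (y + z))
      = fun z => -(ε * ((θ + bump (x + z)) * (2 - e))) - (V (x + z) + V (y + z)) := by
    ext z
    rw [G0_self, G0_of_lt _ _ _ _ (by linarith), add_sub_add_right_eq_sub, ← he]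
    ring
  have hneg : y - x = -(x - y) := by ring
  have hif : IntegrableOn (fun w => ε * ((θ + bump (x + w + (x - y))) * (e - e ^ 2))
      + (V (y + w) - V (x + w))) (Set.Ioi 0) (mShift m (y - x)) :=
    ((h1.mul_const _).const_mul ε).add (hVy.sub hVx)
  have hig : IntegrableOn (fun z => -(ε * ((θ + bump (x + z)) * (2 - e)))
      - (V (x + z) + V (y + z))) (Set.Ioi 0) (mShift m (y - x)) :=
    (((h2.mul_const _).const_mul ε).neg).sub (hVx.add hVy)
  rw [integrableOn_mShift_iff h0, setIntegral_mShift h0, ← hneg, hf, hg]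
  refine ⟨hif, hig, ?_⟩
  rw [← integral_add hif hig, lasso]
  congr 1
  ext w
  rw [← he]
  ring

theorem lasso_le (hfin : ∀ δ > 0, m (Set.Ioi δ) < ⊤) (hVc : Continuous V)
    (hVnonneg : ∀ t, 0 ≤ t → 0 ≤ V t) (hl : 0 < lam0) (hε : 0 ≤ ε) (hθ : 0 ≤ θ)
    (hy : 0 ≤ y) (hxy : y < x)
    (hV : ∀ δ > 0, IntegrableOn (fun z => V (y + z)) (Set.Ioi δ) m) :
    lasso lam0 θ ε V m x y ≤ -(ε * θ * (mShift m (y - x)).real (Set.Ioi 0)) := by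
  have hneg : y - x = -(x - y) := by ring
  have hlt : mShift m (y - x) (Set.Ioi 0) < ⊤ :=
    hneg ▸ mShift_neg_Ioi_lt_top (hfin (x - y) (by linarith))
  have hc : IntegrableOn (fun _ : ℝ => -(ε * θ)) (Set.Ioi 0) (mShift m (y - x)) :=
    integrableOn_const hlt.ne
  have := setIntegral_mono_on (integrableOn_lasso (lam0 := lam0) (θ := θ) (ε := ε) hfin hVc hy
    hxy hV) hc measurableSet_Ioi ?_
  · rw [setIntegral_const, smul_eq_mul] at this
    rw [lasso]
    linarith
  · intro w hw
    have hw0 : 0 < w := hw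
    have hVw := hVnonneg (x + w) (by linarith)
    have he0 := Real.exp_pos (-(lam0 * (x - y)))
    have he1 : Real.exp (-(lam0 * (x - y))) ≤ 1 :=
      Real.exp_le_one_iff.2 (by nlinarith [mul_pos hl (sub_pos.2 hxy)])
    have hb := bump_antitone (show x + w ≤ x + w + (x - y) by linarith)
    have hb0 := bump_nonneg (x + w)
    generalize Real.exp (-(lam0 * (x - y))) = e at *
    generalize bump (x + w) = p at *
    generalize bump (x + w + (x - y)) = q at *
    have h1 : (θ + q) * (e - e ^ 2) ≤ (θ + p) * (e - e ^ 2) :=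
      mul_le_mul_of_nonneg_right (by linarith) (by nlinarith)
    have h2 : (θ + q) * (e - e ^ 2) - (θ + p) * (2 - e) ≤ -θ := by
      nlinarith [mul_nonneg (add_nonneg hθ hb0) (sq_nonneg (1 - e))]
    nlinarith [mul_le_mul_of_nonneg_left h2 hε]

theorem le_lasso (hfin : ∀ δ > 0, m (Set.Ioi δ) < ⊤) (hVc : Continuous V)
    (hVnonneg : ∀ t, 0 ≤ t → 0 ≤ V t) (hl : 0 < lam0) (hε : 0 ≤ ε) (hθ : 0 ≤ θ)
    (hy : 0 ≤ y) (hxy : y < x)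
    (hV : ∀ δ > 0, IntegrableOn (fun z => V (y + z)) (Set.Ioi δ) m) :
    -(2 * ε * (θ + 1) * m.real (Set.Ioi (x - y))) - ∫ z in Set.Ioi (x - y), V (y + z) ∂m
      ≤ lasso lam0 θ ε V m x y := by
  have hneg : y - x = -(x - y) := by ring
  have hlt : mShift m (y - x) (Set.Ioi 0) < ⊤ :=
    hneg ▸ mShift_neg_Ioi_lt_top (hfin (x - y) (by linarith))
  have hc : IntegrableOn (fun _ : ℝ => -(2 * ε * (θ + 1))) (Set.Ioi 0) (mShift m (y - x)) :=
    integrableOn_const hlt.ne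
  have hVx := (integrableOn_add_mShift hfin hVc hxy hV).1
  have h1 : ∫ w in Set.Ioi (0 : ℝ), (-(2 * ε * (θ + 1)) - 2 * V (x + w)) ∂(mShift m (y - x))
      ≤ lasso lam0 θ ε V m x y := by
    refine setIntegral_mono_on (hc.sub (hVx.const_mul 2))
      (integrableOn_lasso hfin hVc hy hxy hV) measurableSet_Ioi fun w hw => ?_
    have hw0 : 0 < w := hw
    have he0 := Real.exp_pos (-(lam0 * (x - y)))
    have he1 : Real.exp (-(lam0 * (x - y))) ≤ 1 :=
      Real.exp_le_one_iff.2 (by nlinarith [mul_pos hl (sub_pos.2 hxy)])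
    have hb0 := bump_nonneg (x + w)
    have hb1 := bump_le_one (show 0 ≤ x + w by linarith)
    have hq0 := bump_nonneg (x + w + (x - y))
    generalize Real.exp (-(lam0 * (x - y))) = e at *
    generalize bump (x + w) = p at *
    generalize bump (x + w + (x - y)) = q at *
    have h2 : 0 ≤ (θ + q) * (e - e ^ 2) := mul_nonneg (by linarith) (by nlinarith)
    have h3 : (θ + p) * (2 - e) ≤ (θ + 1) * 2 := by
      apply mul_le_mul <;> linarith
    nlinarith [mul_le_mul_of_nonneg_left (show -(2 * (θ + 1)) ≤ (θ + q) * (e - e ^ 2)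
      - (θ + p) * (2 - e) by linarith) hε]
  rw [integral_sub hc (hVx.const_mul 2), setIntegral_const, integral_const_mul,
    smul_eq_mul] at h1
  have hVu := hV (x - y) (by linarith)
  have h2 : 2 * ∫ w in Set.Ioi (0 : ℝ), V (x + w) ∂(mShift m (y - x))
      ≤ ∫ z in Set.Ioi (x - y), V (y + z) ∂m := by
    have hfun : (fun z => V (x + (z + -(x - y)))) = fun z => V (y + z) := by
      ext z; congr 1; ring
    have := setIntegral_mShift_neg_le (m := m) (u := x - y) (f := fun w => V (x + w))
      (fun z hz => hVnonneg _ (by linarith)) (by simpa only [hfun] using hVu)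
    rw [hneg]
    simpa only [hfun] using this
  have h3 : (mShift m (y - x)).real (Set.Ioi 0) ≤ m.real (Set.Ioi (x - y)) := by
    refine ENNReal.toReal_mono (hfin (x - y) (by linarith)).ne ?_
    rw [hneg]
    refine (mShift_le_map m _ _).trans ?_
    rw [Measure.smul_apply, Measure.map_apply (by fun_prop) measurableSet_Ioi]
    have : (fun z : ℝ => z + -(x - y)) ⁻¹' Set.Ioi 0 = Set.Ioi (x - y) := by ext z; simp
    rw [this, smul_eq_mul]
    exact mul_le_of_le_one_left zero_le (by simp)
  have h4 := mul_le_mul_of_nonneg_left h3 (show 0 ≤ 2 * ε * (θ + 1) by positivity)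
  linarith

end Lasso

/-- The standing assumptions on the jump measures and on the Lyapunov function. -/
structure JumpRegular (μ ν : Measure ℝ) (V : ℝ → ℝ) : Prop where
  μ_Iic : μ (Set.Iic 0) = 0
  ν_Iic : ν (Set.Iic 0) = 0
  μ_int : IntegrableOn (fun z : ℝ => min 1 (z ^ 2)) (Set.Ioi 0) μ
  ν_int : IntegrableOn (fun z : ℝ => min 1 z) (Set.Ioi 0) ν
  contDiff : ContDiff ℝ 2 V
  nonneg : ∀ t, 0 ≤ t → 0 ≤ V t
  V_μ : ∀ t, 0 ≤ t →
    IntegrableOn (fun z => V (t + z) - V t - deriv V t * cutoff z) (Set.Ioi 0) μ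
  V_ν : ∀ t, 0 ≤ t → IntegrableOn (fun z => V (t + z) - V t) (Set.Ioi 0) ν

/-- The generator `genL` applied to `bump`. -/
noncomputable def genBump (b c β : ℝ) (g : ℝ → ℝ) (μ ν : Measure ℝ) (x : ℝ) : ℝ :=
  c * x * bumpDD x
    + x * (∫ z in Set.Ioi (0 : ℝ), (bump (x + z) - bump x - bumpD x * cutoff z) ∂μ)
    + (β - b * x - g x) * bumpD x
    + ∫ z in Set.Ioi (0 : ℝ), (bump (x + z) - bump x) ∂ν

namespace JumpRegular

variable {μ ν : Measure ℝ} {V : ℝ → ℝ}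

theorem continuous (h : JumpRegular μ ν V) : Continuous V := h.contDiff.continuous

theorem differentiable (h : JumpRegular μ ν V) : Differentiable ℝ V :=
  h.contDiff.differentiable (by norm_num)

theorem differentiable_deriv (h : JumpRegular μ ν V) : Differentiable ℝ (deriv V) :=
  (h.contDiff.deriv' (n := 1)).differentiable (by norm_num)

theorem μ_Ioi_lt_top (h : JumpRegular μ ν V) : ∀ δ > 0, μ (Set.Ioi δ) < ⊤ := fun δ hδ =>
  measure_Ioi_lt_top_of_integrableOn h.μ_int hδ (a := min 1 (δ ^ 2)) (by positivity)
    fun z hz => min_le_min_left _ (by gcongr)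

theorem ν_Ioi_lt_top (h : JumpRegular μ ν V) : ∀ δ > 0, ν (Set.Ioi δ) < ⊤ := fun δ hδ =>
  measure_Ioi_lt_top_of_integrableOn h.ν_int hδ (a := min 1 δ) (by positivity)
    fun z hz => min_le_min_left _ hz.le

theorem integrableOn_μ_Ioi (h : JumpRegular μ ν V) {y : ℝ} (hy : 0 ≤ y) :
    ∀ δ > 0, IntegrableOn (fun z => V (y + z)) (Set.Ioi δ) μ := fun δ hδ => by
  have h1 := (h.V_μ y hy).mono_set (Set.Ioi_subset_Ioi hδ.le)
  have h2 : IntegrableOn (fun z => V y + deriv V y * cutoff z) (Set.Ioi δ) μ := by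
    refine Measure.integrableOn_of_bounded (M := |V y| + |deriv V y|)
      (h.μ_Ioi_lt_top δ hδ).ne
      ((measurable_cutoff.const_mul _).const_add _).aestronglyMeasurable ?_
    filter_upwards [ae_restrict_mem measurableSet_Ioi] with z hz
    have hz0 : 0 < z := hδ.trans hz
    refine (norm_add_le _ _).trans ?_
    rw [norm_mul, Real.norm_eq_abs, Real.norm_eq_abs, Real.norm_eq_abs]
    gcongr
    refine mul_le_of_le_one_right (abs_nonneg _) ?_
    unfold cutoff
    split_ifs with h1
    · rwa [abs_of_pos hz0]
    · simp
  refine (h1.add h2).congr (Filter.Eventually.of_forall fun z => ?_)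
  simp only [Pi.add_apply]
  ring

theorem integrableOn_ν_Ioi (h : JumpRegular μ ν V) {y : ℝ} (hy : 0 ≤ y) :
    ∀ δ > 0, IntegrableOn (fun z => V (y + z)) (Set.Ioi δ) ν := fun δ hδ => by
  have h1 := (h.V_ν y hy).mono_set (Set.Ioi_subset_Ioi hδ.le)
  have h2 : IntegrableOn (fun _ : ℝ => V y) (Set.Ioi δ) ν :=
    integrableOn_const (h.ν_Ioi_lt_top δ hδ).ne
  refine (h1.add h2).congr (Filter.Eventually.of_forall fun z => ?_)
  simp only [Pi.add_apply]
  ring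

/-- Splitting of the coupling generator applied to `G0` into a part from `F0`, the marginal
generators applied to `V`, and the lassoing terms. -/
theorem Ltil_G0_eq (h : JumpRegular μ ν V) {b c β lam0 θ ε : ℝ} (hl : 0 < lam0) (g : ℝ → ℝ)
    {x y : ℝ} (hy : 0 ≤ y) (hxy : y < x) :
    Ltil b c β g μ ν (G0 lam0 (1 / 2) θ ε V) x y
      = ε * ((2 - Real.exp (-(lam0 * (x - y)))) * genBump b c β g μ ν x
          - (θ + bump x) * (Real.exp (-(lam0 * (x - y)))
            * ((x - y) * Psi b c μ lam0 + 4 * c * lam0 ^ 2 * y))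
          - (g x - g y) * ((θ + bump x) * (lam0 * Real.exp (-(lam0 * (x - y)))))
          + 2 * c * (x + y) * (bumpD x * (lam0 * Real.exp (-(lam0 * (x - y)))))
          + (x - y) * (Real.exp (-(lam0 * (x - y)))
            * ∫ z in Set.Ioi (0 : ℝ), (bump (x + z) - bump x) * (1 - Real.exp (-(lam0 * z))) ∂μ))
        + genL b c β g μ ν V x + genL b c β g μ ν V y
        + y * lasso lam0 θ ε V μ x y + lasso lam0 θ ε V ν x y := by
  have hx : 0 ≤ x := hy.trans hxy.le
  have hVd := h.differentiable
  have hVd' := h.differentiable_deriv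
  rw [Ltil, Ltil0, Ltil1,
    (G0_immigration_jump h.ν_int hy hxy (h.V_ν x hx) (h.V_ν y hy)).2,
    (G0_single_branching_jump h.μ_int hl hVd hy hxy (h.V_μ x hx)).2,
    (G0_common_branching_jump h.μ_int hVd hy hxy (h.V_μ x hx) (h.V_μ y hy)).2,
    ← (G0_lasso_jump h.μ_Iic h.μ_Ioi_lt_top h.continuous hy hxy (h.integrableOn_μ_Ioi hy)).2.2,
    ← (G0_lasso_jump h.ν_Iic h.ν_Ioi_lt_top h.continuous hy hxy (h.integrableOn_ν_Ioi hy)).2.2,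
    Fx_G0 _ _ _ hVd hxy, Fy_G0 _ _ _ hVd hxy, Fxx_G0 _ _ _ hVd hVd' hxy,
    Fyy_G0 _ _ _ hVd hVd' hxy, Fxy_G0 _ _ _ hVd hxy]
  simp only [genBump, genL, Psi]
  ring

theorem Ltil_G0_le (h : JumpRegular μ ν V) {b c β lam0 θ ε : ℝ} (hc : 0 ≤ c) (hl : 0 < lam0)
    {g : ℝ → ℝ} (hg : MonotoneOn g (Set.Ici 0)) (hΨ : 0 < Psi b c μ lam0)
    (hθ : 0 ≤ θ) (hε : 0 ≤ ε) {x y : ℝ} (hy : 0 ≤ y) (hxy : y < x) :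
    Ltil b c β g μ ν (G0 lam0 (1 / 2) θ ε V) x y
      ≤ ε * ((2 - Real.exp (-(lam0 * (x - y)))) * genBump b c β g μ ν x
          - θ * (Real.exp (-(lam0 * (x - y)))
              * ((x - y) * Psi b c μ lam0 + 4 * c * lam0 ^ 2 * y)
            + y * (mShift μ (y - x)).real (Set.Ioi 0) + (mShift ν (y - x)).real (Set.Ioi 0)))
        + genL b c β g μ ν V x + genL b c β g μ ν V y := by
  have hx : 0 ≤ x := hy.trans hxy.le
  have hu : 0 ≤ x - y := by linarith
  rw [h.Ltil_G0_eq hl g hy hxy]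
  have hLμ := lasso_le h.μ_Ioi_lt_top h.continuous h.nonneg hl hε hθ hy hxy
    (h.integrableOn_μ_Ioi hy)
  have hLν := lasso_le h.ν_Ioi_lt_top h.continuous h.nonneg hl hε hθ hy hxy
    (h.integrableOn_ν_Ioi hy)
  have hJ : ∫ z in Set.Ioi (0 : ℝ), (bump (x + z) - bump x) * (1 - Real.exp (-(lam0 * z))) ∂μ
      ≤ 0 := by
    refine setIntegral_nonpos measurableSet_Ioi fun z hz => ?_
    have hz0 : 0 < z := hz
    exact mul_nonpos_of_nonpos_of_nonneg
      (by linarith [bump_antitone (show x ≤ x + z by linarith)]) (one_sub_exp_neg_nonneg hl hz0)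
  have hgxy := hg hy hx hxy.le
  have hb := bump_nonneg x
  have hbD := bumpD_nonpos x
  have he := Real.exp_pos (-(lam0 * (x - y)))
  generalize Real.exp (-(lam0 * (x - y))) = e at *
  generalize ∫ z in Set.Ioi (0 : ℝ), (bump (x + z) - bump x) * (1 - Real.exp (-(lam0 * z))) ∂μ
    = J at *
  have h1 : 0 ≤ (g x - g y) * ((θ + bump x) * (lam0 * e)) :=
    mul_nonneg (by linarith) (by positivity)
  have h2 : 2 * c * (x + y) * (bumpD x * (lam0 * e)) ≤ 0 :=
    mul_nonpos_of_nonneg_of_nonpos (by positivity)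
      (mul_nonpos_of_nonpos_of_nonneg hbD (by positivity))
  have h3 : (x - y) * (e * J) ≤ 0 :=
    mul_nonpos_of_nonneg_of_nonpos hu (mul_nonpos_of_nonneg_of_nonpos he.le hJ)
  have h4 : 0 ≤ bump x * (e * ((x - y) * Psi b c μ lam0 + 4 * c * lam0 ^ 2 * y)) := by
    positivity
  have h5 := mul_le_mul_of_nonneg_left hLμ hy
  have h6 := mul_le_mul_of_nonneg_left (show
    -(g x - g y) * ((θ + bump x) * (lam0 * e)) + 2 * c * (x + y) * (bumpD x * (lam0 * e))
      + (x - y) * (e * J)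
      - bump x * (e * ((x - y) * Psi b c μ lam0 + 4 * c * lam0 ^ 2 * y)) ≤ 0 by linarith) hε
  linarith

/-- Uniform dissipation from the branching mechanism and the lassoing coupling. -/
theorem exists_dissipation (h : JumpRegular μ ν V) {b c lam0 l : ℝ} (hc : 0 ≤ c) (hl : 0 < lam0)
    (hl1 : 1 ≤ l) (hΨ : 0 < Psi b c μ lam0)
    (hfluct : 0 < c ∨ ∃ c₀ > (0 : ℝ), ∃ κ₀ > (0 : ℝ), ∀ x : ℝ, |x| ≤ c₀ →
      ENNReal.ofReal κ₀ ≤ (μ ⊓ Measure.map (fun z => z + x) μ) (Set.Ioi 0)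
        + (ν ⊓ Measure.map (fun z => z + x) ν) (Set.Ioi 0)) :
    ∃ κ > (0 : ℝ), ∀ x y : ℝ, 0 ≤ y → y < x → x ≤ l →
      κ * x ≤ Real.exp (-(lam0 * (x - y)))
              * ((x - y) * Psi b c μ lam0 + 4 * c * lam0 ^ 2 * y)
            + y * (mShift μ (y - x)).real (Set.Ioi 0)
            + (mShift ν (y - x)).real (Set.Ioi 0) := by
  set E := Real.exp (-(lam0 * l)) with hE
  have hE0 : 0 < E := Real.exp_pos _
  have hEle : ∀ x y : ℝ, 0 ≤ y → x ≤ l → E ≤ Real.exp (-(lam0 * (x - y))) := fun x y hy hx => by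
    rw [hE]
    gcongr
    linarith
  have hl0 : 0 < l := by linarith
  rcases hfluct with hc | ⟨c₀, hc₀, κ₀, hκ₀, hmass⟩
  · refine ⟨E * min (Psi b c μ lam0) (4 * c * lam0 ^ 2), by positivity, fun x y hy hxy hxl => ?_⟩
    have hu : 0 ≤ x - y := by linarith
    have h1 : min (Psi b c μ lam0) (4 * c * lam0 ^ 2) * x
        ≤ (x - y) * Psi b c μ lam0 + 4 * c * lam0 ^ 2 * y := by
      have h2 := mul_le_mul_of_nonneg_right
        (min_le_left (Psi b c μ lam0) (4 * c * lam0 ^ 2)) hu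
      have h3 := mul_le_mul_of_nonneg_right
        (min_le_right (Psi b c μ lam0) (4 * c * lam0 ^ 2)) hy
      linarith
    have h2 : E * (min (Psi b c μ lam0) (4 * c * lam0 ^ 2) * x)
        ≤ Real.exp (-(lam0 * (x - y))) * ((x - y) * Psi b c μ lam0 + 4 * c * lam0 ^ 2 * y) :=
      mul_le_mul (hEle x y hy hxl) h1
        (mul_nonneg (by positivity) (by linarith)) (Real.exp_pos _).le
    have h3 : 0 ≤ y * (mShift μ (y - x)).real (Set.Ioi 0) := by positivity
    have h4 : 0 ≤ (mShift ν (y - x)).real (Set.Ioi 0) := by positivity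
    linarith
  · refine ⟨min (E * Psi b c μ lam0 * min 1 (c₀ / l)) (κ₀ / (2 * l)), by positivity,
      fun x y hy hxy hxl => ?_⟩
    have hx : 0 < x := by linarith
    have hu : 0 ≤ x - y := by linarith
    set mμ := (mShift μ (y - x)).real (Set.Ioi 0) with hmμ
    set mν := (mShift ν (y - x)).real (Set.Ioi 0) with hmν
    have hmμ0 : 0 ≤ mμ := measureReal_nonneg
    have hmν0 : 0 ≤ mν := measureReal_nonneg
    set P := Psi b c μ lam0 with hP
    have h2 : E * (P * (x - y))
        ≤ Real.exp (-(lam0 * (x - y))) * ((x - y) * P + 4 * c * lam0 ^ 2 * y) := by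
      refine mul_le_mul (hEle x y hy hxl) ?_ (by positivity) (Real.exp_pos _).le
      have : 0 ≤ 4 * c * lam0 ^ 2 * y := by positivity
      linarith
    have hy0 : 0 ≤ y * mμ := by positivity
    rcases le_or_gt (x - y) c₀ with hle | hgt
    · have hm : κ₀ / 2 ≤ mμ + mν := by
        have h3 := hmass (y - x) (by rw [abs_sub_comm, abs_of_nonneg hu]; exact hle)
        have hneg : y - x = -(x - y) := by ring
        have hfμ : mShift μ (y - x) (Set.Ioi 0) < ⊤ :=
          hneg ▸ mShift_neg_Ioi_lt_top (h.μ_Ioi_lt_top (x - y) (by linarith))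
        have hfν : mShift ν (y - x) (Set.Ioi 0) < ⊤ :=
          hneg ▸ mShift_neg_Ioi_lt_top (h.ν_Ioi_lt_top (x - y) (by linarith))
        have h4 : (2⁻¹ : ENNReal) * ENNReal.ofReal κ₀
            ≤ mShift μ (y - x) (Set.Ioi 0) + mShift ν (y - x) (Set.Ioi 0) := by
          rw [mShift, mShift, Measure.smul_apply, Measure.smul_apply, smul_eq_mul, smul_eq_mul,
            ← mul_add]
          gcongr
        have h5 := ENNReal.toReal_mono (ENNReal.add_lt_top.2 ⟨hfμ, hfν⟩).ne h4
        rw [ENNReal.toReal_add hfμ.ne hfν.ne, ENNReal.toReal_mul,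
          ENNReal.toReal_ofReal hκ₀.le, ENNReal.toReal_inv, ENNReal.toReal_ofNat] at h5
        change 2⁻¹ * κ₀ ≤ mμ + mν at h5
        linarith
      have h6 : y / l * (κ₀ / 2) ≤ y * mμ + mν := by
        have hyl : y / l ≤ 1 := (div_le_one hl0).2 (by linarith)
        have hyl' : y / l ≤ y := div_le_self hy hl1
        have hyl0 : 0 ≤ y / l := by positivity
        calc y / l * (κ₀ / 2) ≤ y / l * (mμ + mν) := by gcongr
          _ = y / l * mμ + y / l * mν := by ring
          _ ≤ y * mμ + 1 * mν := by gcongr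
          _ = _ := by ring
      have h7 : min (E * P * min 1 (c₀ / l)) (κ₀ / (2 * l)) * (x - y) ≤ E * P * 1 * (x - y) := by
        gcongr
        exact (min_le_left _ _).trans (by gcongr; exact min_le_left _ _)
      have h8 : min (E * P * min 1 (c₀ / l)) (κ₀ / (2 * l)) * y ≤ κ₀ / (2 * l) * y := by
        gcongr
        exact min_le_right _ _
      have h9 : κ₀ / (2 * l) * y = y / l * (κ₀ / 2) := by field_simp
      linarith
    · have h7 : min (E * P * min 1 (c₀ / l)) (κ₀ / (2 * l)) * x ≤ E * P * (c₀ / l) * x := by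
        gcongr
        exact (min_le_left _ _).trans (by gcongr; exact min_le_right _ _)
      have h8 : c₀ / l * x ≤ x - y := by
        have : c₀ / l * x ≤ c₀ := by
          rw [div_mul_eq_mul_div, div_le_iff₀ hl0]
          gcongr
        linarith
      have h9 : E * P * (c₀ / l * x) ≤ E * P * (x - y) := by gcongr
      linarith

theorem genBump_eq_zero (b c β : ℝ) (g : ℝ → ℝ) (μ ν : Measure ℝ) {x : ℝ} (hx : 1 / 2 ≤ x) :
    genBump b c β g μ ν x = 0 := by
  obtain ⟨h0, h1, h2⟩ := bump_eq_zero hx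
  have hμ : ∫ z in Set.Ioi (0 : ℝ), (bump (x + z) - bump x - bumpD x * cutoff z) ∂μ = 0 := by
    refine setIntegral_eq_zero_of_forall_eq_zero fun z hz => ?_
    have hz0 : 0 < z := hz
    rw [h0, h1, (bump_eq_zero (show 1 / 2 ≤ x + z by linarith)).1]
    ring
  have hν : ∫ z in Set.Ioi (0 : ℝ), (bump (x + z) - bump x) ∂ν = 0 := by
    refine setIntegral_eq_zero_of_forall_eq_zero fun z hz => ?_
    have hz0 : 0 < z := hz
    rw [h0, (bump_eq_zero (show 1 / 2 ≤ x + z by linarith)).1]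
    ring
  rw [genBump, hμ, hν, h1, h2]
  ring

theorem exists_genBump_le (h : JumpRegular μ ν V) {b c β lam0 : ℝ} (hc : 0 ≤ c) (hβ : 0 ≤ β)
    (hl : 0 < lam0) {g : ℝ → ℝ} (hg0 : g 0 = 0) (hgmono : MonotoneOn g (Set.Ici 0))
    (hgcont : ContinuousOn g (Set.Ici 0)) (hΦ : 0 < Phi β ν lam0) :
    ∃ C ≥ (0 : ℝ), ∃ η > (0 : ℝ), ∃ x₁ > (0 : ℝ),
      (∀ x, 0 ≤ x → x ≤ x₁ → genBump b c β g μ ν x ≤ C * x - η) ∧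
      (∀ x, 0 ≤ x → genBump b c β g μ ν x ≤ C * x + 6 * g (1 / 2)) := by
  set N := ∫ z in Set.Ioi (0 : ℝ), min 1 (z ^ 2) ∂μ with hN
  set N' := ∫ z in Set.Ioi (0 : ℝ), min 1 z ∂ν with hN'
  have hN0 : 0 ≤ N := setIntegral_nonneg measurableSet_Ioi fun z _ => by positivity
  have hN'0 : 0 ≤ N' := setIntegral_nonneg measurableSet_Ioi fun z hz =>
    le_min zero_le_one (le_of_lt hz)
  have hpos : 0 < β + N' := by
    by_contra hcon
    have hβ0 : β = 0 := by linarith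
    have hN'z : N' = 0 := by linarith
    have h1 := abs_setIntegral_Ioi_le (f := fun z => 1 - Real.exp (-(lam0 * z)))
      (C := lam0 + 1) h.ν_int fun z hz => by
        rw [abs_of_nonneg (one_sub_exp_neg_nonneg hl hz)]
        exact one_sub_exp_neg_le hl hz
    rw [← hN', hN'z, mul_zero] at h1
    rw [Phi, hβ0] at hΦ
    linarith [le_abs_self (∫ z in Set.Ioi (0 : ℝ), (1 - Real.exp (-(lam0 * z))) ∂ν)]
  have hgen : ∀ x, 0 ≤ x → genBump b c β g μ ν x ≤ (24 * c + 6 * |b| + 24 * N) * x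
      - g x * bumpD x + β * bumpD x + ∫ z in Set.Ioi (0 : ℝ), (bump (x + z) - bump x) ∂ν := by
    intro x hx
    have h1 := (le_abs_self _).trans (abs_setIntegral_Ioi_le h.μ_int
      fun z hz => abs_bump_taylor_le hx hz)
    rw [← hN] at h1
    have h2 := mul_le_mul_of_nonneg_left (bumpDD_le hx) (mul_nonneg hc hx)
    have h3 : -(b * bumpD x) ≤ 6 * |b| := by
      have hD : |bumpD x| ≤ 6 := abs_le.2 ⟨neg_six_le_bumpD hx, by linarith [bumpD_nonpos x]⟩
      calc -(b * bumpD x) ≤ |b * bumpD x| := neg_le_abs _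
        _ = |b| * |bumpD x| := abs_mul _ _
        _ ≤ |b| * 6 := by gcongr
        _ = _ := by ring
    have h4 := mul_le_mul_of_nonneg_left h3 hx
    have h5 := mul_le_mul_of_nonneg_left h1 hx
    rw [genBump]
    linarith
  have hgnn : ∀ x, 0 ≤ x → 0 ≤ g x := fun x hx =>
    hg0.symm.le.trans (hgmono Set.self_mem_Ici hx hx)
  have hJ0 : ∀ x, ∫ z in Set.Ioi (0 : ℝ), (bump (x + z) - bump x) ∂ν ≤ 0 := fun x =>
    setIntegral_nonpos measurableSet_Ioi fun z hz => by
      have hz0 : 0 < z := hz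
      linarith [bump_antitone (show x ≤ x + z by linarith)]
  set η := (3 / 2 * β + 1 / 8 * N') / 2 with hη
  have hη0 : 0 < η := by rw [hη]; linarith
  obtain ⟨x₁, hx₁, hx₁4, hgx₁⟩ : ∃ x₁ > (0 : ℝ), x₁ ≤ 1 / 4 ∧ g x₁ < η / 6 := by
    have htend : Filter.Tendsto g (nhdsWithin 0 (Set.Ioi 0)) (nhds 0) := by
      have := (hgcont 0 Set.self_mem_Ici).mono_left
        (nhdsWithin_mono 0 Set.Ioi_subset_Ici_self)
      rwa [hg0] at this
    have hev := htend.eventually (gt_mem_nhds (show (0 : ℝ) < η / 6 by positivity))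
    have hev2 : ∀ᶠ t in nhdsWithin (0 : ℝ) (Set.Ioi 0), t ∈ Set.Ioc (0 : ℝ) (1 / 4) :=
      Ioc_mem_nhdsGT (by norm_num)
    obtain ⟨t, ht1, ht2⟩ := (hev.and hev2).exists
    exact ⟨t, ht2.1, ht2.2, ht1⟩
  refine ⟨24 * c + 6 * |b| + 24 * N, by positivity, η, hη0, x₁, hx₁, fun x hx hxx₁ => ?_,
    fun x hx => ?_⟩
  · have h1 := hgen x hx
    have h2 : ∫ z in Set.Ioi (0 : ℝ), (bump (x + z) - bump x) ∂ν ≤ -(1 / 8 * N') := by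
      have := setIntegral_mono_on (integrableOn_bump_sub h.ν_int hx)
        (h.ν_int.const_mul (-(1 / 8))) measurableSet_Ioi (fun z hz => by
          have := bump_add_sub_le (show x ≤ 1 / 4 by linarith) hz
          linarith)
      rw [integral_const_mul] at this
      linarith
    have h3 : bumpD x ≤ -(3 / 2) := by
      rw [bumpD, max_eq_right (by linarith)]
      nlinarith
    have h4 : g x ≤ η / 6 := (hgmono hx hx₁.le hxx₁).trans hgx₁.le
    have h5 := hgnn x hx
    have h6 : -(g x * bumpD x) ≤ η := by nlinarith [neg_six_le_bumpD hx]
    have h7 : β * bumpD x ≤ β * -(3 / 2) := mul_le_mul_of_nonneg_left h3 hβ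
    linarith
  · rcases le_or_gt (1 / 2) x with hge | hlt
    · rw [genBump_eq_zero b c β g μ ν hge]
      have := hgnn (1 / 2) (by norm_num)
      positivity
    · have h1 := hgen x hx
      have h4 : g x ≤ g (1 / 2) := hgmono hx (by norm_num : (0 : ℝ) ≤ 1 / 2) hlt.le
      have h5 := hgnn x hx
      have h6 : -(g x * bumpD x) ≤ 6 * g (1 / 2) := by nlinarith [neg_six_le_bumpD hx]
      have h7 : β * bumpD x ≤ 0 := mul_nonpos_of_nonneg_of_nonpos hβ (bumpD_nonpos x)
      linarith [hJ0 x]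

/-- Contraction of the `F0`-part of the generator on `{x ≤ l}`, and its nonpositivity beyond. -/
theorem exists_contraction (h : JumpRegular μ ν V) {b c β lam0 l : ℝ} (hc : 0 ≤ c)
    (hβ : 0 ≤ β) (hl : 0 < lam0) (hl1 : 1 ≤ l) {g : ℝ → ℝ} (hg0 : g 0 = 0)
    (hgmono : MonotoneOn g (Set.Ici 0)) (hgcont : ContinuousOn g (Set.Ici 0))
    (hΨ : 0 < Psi b c μ lam0) (hΦ : 0 < Phi β ν lam0)
    (hfluct : 0 < c ∨ ∃ c₀ > (0 : ℝ), ∃ κ₀ > (0 : ℝ), ∀ x : ℝ, |x| ≤ c₀ →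
      ENNReal.ofReal κ₀ ≤ (μ ⊓ Measure.map (fun z => z + x) μ) (Set.Ioi 0)
        + (ν ⊓ Measure.map (fun z => z + x) ν) (Set.Ioi 0)) :
    ∃ θ ≥ (4 : ℝ), ∃ d > (0 : ℝ), ∀ ε, 0 ≤ ε → ∀ x y, 0 ≤ y → y < x →
      (x ≤ l → Ltil b c β g μ ν (G0 lam0 (1 / 2) θ ε V) x y
        ≤ -(ε * d) + genL b c β g μ ν V x + genL b c β g μ ν V y) ∧
      (l ≤ x → Ltil b c β g μ ν (G0 lam0 (1 / 2) θ ε V) x y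
        ≤ genL b c β g μ ν V x + genL b c β g μ ν V y) := by
  obtain ⟨κ, hκ, hdiss⟩ := h.exists_dissipation hc hl hl1 hΨ hfluct
  obtain ⟨C, hC, η, hη, x₁, hx₁, hsmall, hall⟩ :=
    h.exists_genBump_le (b := b) hc hβ hl hg0 hgmono hgcont hΦ
  have hgh : 0 ≤ g (1 / 2) :=
    hg0.symm.le.trans (hgmono Set.self_mem_Ici (by norm_num : (0 : ℝ) ≤ 1 / 2) (by norm_num))
  set θ := 4 + (2 * C + (12 * g (1 / 2) + 1) / x₁) / κ with hθ
  have hθ4 : 4 ≤ θ := by rw [hθ, le_add_iff_nonneg_right]; positivity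
  have hθκ : 2 * C + (12 * g (1 / 2) + 1) / x₁ ≤ θ * κ := by
    rw [hθ, add_mul, div_mul_cancel₀ _ hκ.ne']
    linarith
  have hq : 0 ≤ (12 * g (1 / 2) + 1) / x₁ := by positivity
  refine ⟨θ, hθ4, min η 1, lt_min hη one_pos, fun ε hε x y hy hxy => ⟨fun hxl => ?_,
    fun hlx => ?_⟩⟩
  all_goals
    have hx : 0 ≤ x := hy.trans hxy.le
    have he0 := Real.exp_pos (-(lam0 * (x - y)))
    have he1 : Real.exp (-(lam0 * (x - y))) ≤ 1 :=
      Real.exp_le_one_iff.2 (by nlinarith [mul_pos hl (sub_pos.2 hxy)])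
    have hup := h.Ltil_G0_le (β := β) hc hl hgmono hΨ (show 0 ≤ θ by linarith) hε hy hxy
  · have hd := mul_le_mul_of_nonneg_left (hdiss x y hy hxy hxl) (show 0 ≤ θ by linarith)
    have hθx : (2 * C + (12 * g (1 / 2) + 1) / x₁) * x ≤ θ * κ * x := by gcongr
    have hCx : 0 ≤ C * x := by positivity
    have key : (2 - Real.exp (-(lam0 * (x - y)))) * genBump b c β g μ ν x - θ * (κ * x)
        ≤ -(min η 1) := by
      generalize Real.exp (-(lam0 * (x - y))) = e at *
      rcases le_or_gt x x₁ with hle | hgt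
      · have h1 := mul_le_mul_of_nonneg_left (hsmall x hx hle) (show 0 ≤ 2 - e by linarith)
        have h2 : (2 - e) * (C * x - η) ≤ 2 * C * x - η := by nlinarith
        have h3 : 0 ≤ (12 * g (1 / 2) + 1) / x₁ * x := by positivity
        linarith [min_le_left η 1]
      · have h1 := mul_le_mul_of_nonneg_left (hall x hx) (show 0 ≤ 2 - e by linarith)
        have h2 : (2 - e) * (C * x + 6 * g (1 / 2)) ≤ 2 * (C * x + 6 * g (1 / 2)) := by
          gcongr
          linarith
        have h3 : 12 * g (1 / 2) + 1 ≤ (12 * g (1 / 2) + 1) / x₁ * x := by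
          rw [div_mul_eq_mul_div, le_div_iff₀ hx₁]
          gcongr
        linarith [min_le_right η 1]
    have h1 := (sub_le_sub_left hd
      ((2 - Real.exp (-(lam0 * (x - y)))) * genBump b c β g μ ν x)).trans key
    have h2 := mul_le_mul_of_nonneg_left h1 hε
    linarith
  · rw [genBump_eq_zero b c β g μ ν (by linarith), mul_zero] at hup
    have h1 : 0 ≤ Real.exp (-(lam0 * (x - y)))
              * ((x - y) * Psi b c μ lam0 + 4 * c * lam0 ^ 2 * y)
            + y * (mShift μ (y - x)).real (Set.Ioi 0) + (mShift ν (y - x)).real (Set.Ioi 0) := by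
      have : 0 ≤ x - y := by linarith
      positivity
    have h2 := mul_nonneg hε (mul_nonneg (show 0 ≤ θ by linarith) h1)
    linarith

end JumpRegular

theorem neg_mul_integral_le_sub {m : Measure ℝ} {w f f' : ℝ → ℝ} {K u : ℝ} (hu : 0 ≤ u)
    (hw : IntegrableOn w (Set.Ioi 0) m) (hf : IntegrableOn f (Set.Ioi 0) m)
    (hf' : IntegrableOn f' (Set.Ioi u) m) (h1 : ∀ z, 0 < z → z ≤ u → -K * w z ≤ f z)
    (h2 : ∀ z, u < z → -K * w z ≤ f z - f' z) :
    -K * ∫ z in Set.Ioi (0 : ℝ), w z ∂m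
      ≤ (∫ z in Set.Ioi (0 : ℝ), f z ∂m) - ∫ z in Set.Ioi u, f' z ∂m := by
  have hsub : Set.Ioi u ⊆ Set.Ioi 0 := Set.Ioi_subset_Ioi hu
  have hind : IntegrableOn ((Set.Ioi u).indicator f') (Set.Ioi 0) m := by
    rw [integrableOn_indicator_iff measurableSet_Ioi, Set.inter_eq_left.2 hsub]
    exact hf'
  have hf_int : ∫ z in Set.Ioi u, f' z ∂m
      = ∫ z in Set.Ioi (0 : ℝ), (Set.Ioi u).indicator f' z ∂m := by
    rw [setIntegral_indicator measurableSet_Ioi, Set.inter_eq_right.2 hsub]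
  rw [hf_int, ← integral_sub hf hind, ← integral_const_mul]
  refine setIntegral_mono_on (hw.const_mul _) (hf.sub hind) measurableSet_Ioi fun z hz => ?_
  rcases le_or_gt z u with hzu | hzu
  · rw [Set.indicator_of_notMem (by simpa using hzu), sub_zero]
    exact h1 z hz hzu
  · rw [Set.indicator_of_mem (Set.mem_Ioi.2 hzu)]
    exact h2 z hzu

namespace JumpRegular

variable {μ ν : Measure ℝ} {V : ℝ → ℝ}

/-- Local lower bound for the generator applied to `V`, after removal of the jumps that are larger
than `u`. -/
theorem exists_neg_le_genL (h : JumpRegular μ ν V) {b c β R δ : ℝ} (hc : 0 ≤ c) (hβ : 0 ≤ β)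
    (hR : 0 ≤ R) (hδ : 0 < δ) {g : ℝ → ℝ} (hg0 : g 0 = 0) (hgmono : MonotoneOn g (Set.Ici 0)) :
    ∃ C, ∀ y u, 0 ≤ y → y ≤ R → δ ≤ u →
      -C ≤ genL b c β g μ ν V y - y * (∫ z in Set.Ioi u, V (y + z) ∂μ)
        - ∫ z in Set.Ioi u, V (y + z) ∂ν := by
  obtain ⟨M, hM, hb⟩ := exists_taylor_bound h.contDiff R
  set N := ∫ z in Set.Ioi (0 : ℝ), min 1 (z ^ 2) ∂μ with hN
  set N' := ∫ z in Set.Ioi (0 : ℝ), min 1 z ∂ν with hN'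
  have hN0 : 0 ≤ N := setIntegral_nonneg measurableSet_Ioi fun z _ => by positivity
  set K := 2 * M / min 1 (δ ^ 2) with hK
  set K' := 2 * M / min 1 δ with hK'
  have hK0 : 0 ≤ K := by positivity
  have hKM : K * min 1 (δ ^ 2) = 2 * M := div_mul_cancel₀ _ (by positivity)
  have hKM' : K' * min 1 δ = 2 * M := div_mul_cancel₀ _ (by positivity)
  have hK2 : 2 * M ≤ K := hKM ▸ mul_le_of_le_one_right hK0 (min_le_left _ _)
  have hK'0 : 0 ≤ K' := by positivity
  have hK'2 : 2 * M ≤ K' := hKM' ▸ mul_le_of_le_one_right hK'0 (min_le_left _ _)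
  refine ⟨c * R * M + R * (K * N) + (β + |b| * R + g R) * M + K' * N', fun y u hy hyR hu => ?_⟩
  obtain ⟨hV0, hV1, hV2, hT⟩ := hb y hy hyR
  have hu0 : 0 < u := hδ.trans_le hu
  have hVy := le_of_abs_le hV0
  have hcut : ∀ z, 0 < z → deriv V y * cutoff z ≤ M := fun z hz => by
    have h1 : |cutoff z| ≤ 1 := by
      unfold cutoff
      split_ifs with hz1
      · rwa [abs_of_pos hz]
      · simp
    calc _ ≤ |deriv V y * cutoff z| := le_abs_self _
      _ = |deriv V y| * |cutoff z| := abs_mul _ _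
      _ ≤ M * 1 := by gcongr
      _ = M := mul_one M
  have hμ := neg_mul_integral_le_sub (K := K) hu0.le h.μ_int (h.V_μ y hy)
    (h.integrableOn_μ_Ioi hy u hu0)
    (fun z hz _ => by
      rcases le_or_gt z 1 with hz1 | hz1
      · have h1 := neg_le_of_abs_le (hT z hz hz1).2
        rw [min_eq_right (by nlinarith), cutoff, if_pos hz1]
        nlinarith [sq_nonneg z]
      · rw [min_eq_left (by nlinarith), cutoff, if_neg (by linarith)]
        linarith [h.nonneg (y + z) (by linarith)])
    (fun z hz => by
      have h1 : min 1 (δ ^ 2) ≤ min 1 (z ^ 2) := min_le_min_left _ (by gcongr; linarith)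
      have h2 := mul_le_mul_of_nonneg_left h1 hK0
      linarith [hcut z (by linarith)])
  have hν := neg_mul_integral_le_sub (K := K') hu0.le h.ν_int (h.V_ν y hy)
    (h.integrableOn_ν_Ioi hy u hu0)
    (fun z hz _ => by
      rcases le_or_gt z 1 with hz1 | hz1
      · have h1 := neg_le_of_abs_le (hT z hz hz1).1
        rw [min_eq_right hz1]
        nlinarith
      · rw [min_eq_left hz1.le]
        linarith [h.nonneg (y + z) (by linarith)])
    (fun z hz => by
      have h1 : min 1 δ ≤ min 1 z := min_le_min_left _ (by linarith)
      have h2 := mul_le_mul_of_nonneg_left h1 hK'0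
      linarith)
  rw [← hN] at hμ
  rw [← hN'] at hν
  have hgy : 0 ≤ g y := hg0.symm.le.trans (hgmono Set.self_mem_Ici hy hy)
  have hgR : g y ≤ g R := hgmono hy hR hyR
  have h1 : -(c * R * M) ≤ c * y * deriv (deriv V) y := by
    refine neg_le_of_abs_le ?_
    rw [abs_mul, abs_of_nonneg (mul_nonneg hc hy)]
    gcongr
  have h2 : -((β + |b| * R + g R) * M) ≤ (β - b * y - g y) * deriv V y := by
    refine neg_le_of_abs_le ?_
    rw [abs_mul]
    gcongr
    · have := abs_nonneg b
      have : 0 ≤ g R := hgy.trans hgR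
      positivity
    · have h3 : |b * y| ≤ |b| * R := by
        rw [abs_mul, abs_of_nonneg hy]
        gcongr
      rw [abs_le] at h3 ⊢
      constructor <;> linarith
  have h3 := mul_le_mul_of_nonneg_left hμ hy
  have h4 : y * (K * N) ≤ R * (K * N) := by gcongr
  rw [genL]
  linarith

theorem exists_abs_genBump_le (h : JumpRegular μ ν V) {b c β R : ℝ} (hc : 0 ≤ c) (hβ : 0 ≤ β)
    (hR : 0 ≤ R) {g : ℝ → ℝ} (hg0 : g 0 = 0) (hgmono : MonotoneOn g (Set.Ici 0)) :
    ∃ B, ∀ x, 0 ≤ x → x ≤ R → |genBump b c β g μ ν x| ≤ B := by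
  set N := ∫ z in Set.Ioi (0 : ℝ), min 1 (z ^ 2) ∂μ with hN
  set N' := ∫ z in Set.Ioi (0 : ℝ), min 1 z ∂ν with hN'
  have hN0 : 0 ≤ N := setIntegral_nonneg measurableSet_Ioi fun z _ => by positivity
  refine ⟨c * R * 24 + R * (24 * N) + (β + |b| * R + g R) * 6 + 6 * N', fun x hx hxR => ?_⟩
  have hgx : 0 ≤ g x := hg0.symm.le.trans (hgmono Set.self_mem_Ici hx hx)
  have hgR : g x ≤ g R := hgmono hx hR hxR
  rw [genBump]
  refine (abs_add_le _ _).trans (add_le_add ((abs_add_le _ _).trans (add_le_add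
    ((abs_add_le _ _).trans (add_le_add ?_ ?_)) ?_)) ?_)
  · rw [abs_mul, abs_of_nonneg (mul_nonneg hc hx), abs_of_nonneg (bumpDD_nonneg x)]
    gcongr
    · exact bumpDD_nonneg x
    · exact bumpDD_le hx
  · rw [abs_mul, abs_of_nonneg hx]
    gcongr
    exact abs_setIntegral_Ioi_le h.μ_int fun z hz => abs_bump_taylor_le hx hz
  · rw [abs_mul]
    gcongr
    · have := abs_nonneg b
      have : 0 ≤ g R := hgx.trans hgR
      positivity
    · have h3 : |b * x| ≤ |b| * R := by
        rw [abs_mul, abs_of_nonneg hx]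
        gcongr
      rw [abs_le] at h3 ⊢
      constructor <;> linarith
    · exact abs_le.2 ⟨neg_six_le_bumpD hx, by linarith [bumpD_nonpos x]⟩
  · exact abs_setIntegral_Ioi_le h.ν_int fun z hz => abs_bump_add_sub_le hx hz

/-- The coupling generator applied to `G0` is bounded below on compact subsets of `DeltaC`. -/
theorem exists_neg_le_Ltil_G0 (h : JumpRegular μ ν V) {b c β lam0 θ ε R δ : ℝ} (hc : 0 ≤ c)
    (hβ : 0 ≤ β) (hl : 0 < lam0) (hθ : 0 ≤ θ) (hε : 0 ≤ ε) (hR : 0 ≤ R) (hδ : 0 < δ)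
    {g : ℝ → ℝ} (hg0 : g 0 = 0) (hgmono : MonotoneOn g (Set.Ici 0))
    (hΨ : 0 < Psi b c μ lam0) :
    ∃ C, ∀ x y, 0 ≤ y → x ≤ R → δ ≤ x - y →
      -C ≤ Ltil b c β g μ ν (G0 lam0 (1 / 2) θ ε V) x y := by
  obtain ⟨C, hC⟩ := h.exists_neg_le_genL (b := b) hc hβ hR hδ hg0 hgmono
  obtain ⟨B, hB⟩ := h.exists_abs_genBump_le (b := b) hc hβ hR hg0 hgmono
  set N := ∫ z in Set.Ioi (0 : ℝ), min 1 (z ^ 2) ∂μ with hN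
  have hN0 : 0 ≤ N := setIntegral_nonneg measurableSet_Ioi fun z _ => by positivity
  refine ⟨ε * (2 * B + (θ + 1) * (R * Psi b c μ lam0 + 4 * c * lam0 ^ 2 * R)
      + g R * ((θ + 1) * lam0) + 2 * c * (2 * R) * (6 * lam0)
      + R * (6 * (lam0 + 1) * N)) + 2 * C
      + R * (2 * ε * (θ + 1) * μ.real (Set.Ioi δ)) + 2 * ε * (θ + 1) * ν.real (Set.Ioi δ),
    fun x y hy hxR hu => ?_⟩
  have hxy : y < x := by linarith
  have hx : 0 ≤ x := hy.trans hxy.le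
  have hyR : y ≤ R := by linarith
  have huR : x - y ≤ R := by linarith
  have hu0 : 0 ≤ x - y := by linarith
  have hCx := hC x δ hx hxR le_rfl
  have hCy := hC y (x - y) hy hyR hu
  have hVμ : 0 ≤ x * ∫ z in Set.Ioi δ, V (x + z) ∂μ :=
    mul_nonneg hx (setIntegral_nonneg measurableSet_Ioi fun z hz =>
      h.nonneg _ (by linarith [Set.mem_Ioi.1 hz]))
  have hVν : 0 ≤ ∫ z in Set.Ioi δ, V (x + z) ∂ν :=
    setIntegral_nonneg measurableSet_Ioi fun z hz =>
      h.nonneg _ (by linarith [Set.mem_Ioi.1 hz])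
  have hLμ := mul_le_mul_of_nonneg_left (le_lasso h.μ_Ioi_lt_top h.continuous h.nonneg hl hε hθ
    hy hxy (h.integrableOn_μ_Ioi hy)) hy
  have hLν := le_lasso h.ν_Ioi_lt_top h.continuous h.nonneg hl hε hθ hy hxy
    (h.integrableOn_ν_Ioi hy)
  have hmμ : y * (2 * ε * (θ + 1) * μ.real (Set.Ioi (x - y)))
      ≤ R * (2 * ε * (θ + 1) * μ.real (Set.Ioi δ)) := by
    gcongr
    exact (h.μ_Ioi_lt_top δ hδ).ne
  have hmν : 2 * ε * (θ + 1) * ν.real (Set.Ioi (x - y))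
      ≤ 2 * ε * (θ + 1) * ν.real (Set.Ioi δ) := by
    gcongr
    exact (h.ν_Ioi_lt_top δ hδ).ne
  have he0 := Real.exp_pos (-(lam0 * (x - y)))
  have he1 : Real.exp (-(lam0 * (x - y))) ≤ 1 := Real.exp_le_one_iff.2 (by
    have := mul_nonneg hl.le hu0
    linarith)
  have hJ := abs_setIntegral_Ioi_le (f := fun z =>
    (bump (x + z) - bump x) * (1 - Real.exp (-(lam0 * z)))) h.μ_int
    fun z hz => abs_bump_sub_mul_le hl hx hz
  rw [← hN] at hJ
  have hb0 := bump_nonneg x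
  have hb1 := bump_le_one hx
  have hgy : 0 ≤ g y := hg0.symm.le.trans (hgmono Set.self_mem_Ici hy hy)
  have hgxy : g y ≤ g x := hgmono hy hx hxy.le
  have hgR : g x ≤ g R := hgmono hx hR hxR
  have hBx := hB x hx hxR
  rw [h.Ltil_G0_eq hl g hy hxy]
  generalize Real.exp (-(lam0 * (x - y))) = e at *
  generalize ∫ z in Set.Ioi (0 : ℝ), (bump (x + z) - bump x) * (1 - Real.exp (-(lam0 * z))) ∂μ
    = J at *
  have h1 : -(2 * B) ≤ (2 - e) * genBump b c β g μ ν x := by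
    refine neg_le_of_abs_le ?_
    rw [abs_mul, abs_of_nonneg (by linarith : 0 ≤ 2 - e)]
    gcongr
    linarith
  have h2 : (θ + bump x) * (e * ((x - y) * Psi b c μ lam0 + 4 * c * lam0 ^ 2 * y))
      ≤ (θ + 1) * (R * Psi b c μ lam0 + 4 * c * lam0 ^ 2 * R) := by
    gcongr
    refine (mul_le_of_le_one_left (by positivity) he1).trans ?_
    gcongr
  have h3 : (g x - g y) * ((θ + bump x) * (lam0 * e)) ≤ g R * ((θ + 1) * lam0) := by
    gcongr
    · linarith
    · linarith
    · exact mul_le_of_le_one_right hl.le he1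
  have h4 : -(2 * c * (2 * R) * (6 * lam0)) ≤ 2 * c * (x + y) * (bumpD x * (lam0 * e)) := by
    refine neg_le_of_abs_le ?_
    rw [abs_mul, abs_of_nonneg (by positivity : 0 ≤ 2 * c * (x + y)), abs_mul,
      abs_of_nonneg (by positivity : 0 ≤ lam0 * e)]
    gcongr
    · linarith
    · exact abs_le.2 ⟨neg_six_le_bumpD hx, by linarith [bumpD_nonpos x]⟩
    · exact mul_le_of_le_one_right hl.le he1
  have h5 : -(R * (6 * (lam0 + 1) * N)) ≤ (x - y) * (e * J) := by
    refine neg_le_of_abs_le ?_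
    rw [abs_mul, abs_of_nonneg hu0, abs_mul, abs_of_pos he0]
    exact mul_le_mul huR ((mul_le_of_le_one_left (abs_nonneg J) he1).trans hJ) (by positivity) hR
  have h6 := mul_le_mul_of_nonneg_left (add_le_add (add_le_add (add_le_add (add_le_add h1
    (neg_le_neg h2)) (neg_le_neg h3)) h4) h5) hε
  linarith

theorem inDomLtil_G0 (h : JumpRegular μ ν V) {b c β lam0 θ ε : ℝ} (hc : 0 ≤ c)
    (hβ : 0 ≤ β) (hl : 0 < lam0) (hθ : 0 ≤ θ) (hε : 0 ≤ ε)
    {g : ℝ → ℝ} (hg0 : g 0 = 0) (hgmono : MonotoneOn g (Set.Ici 0))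
    (hΨ : 0 < Psi b c μ lam0)
    (hnonpos : ∀ x y, 0 ≤ y → y < x → Ltil b c β g μ ν (G0 lam0 (1 / 2) θ ε V) x y ≤ 0) :
    InDomLtil b c β g μ ν (G0 lam0 (1 / 2) θ ε V) := by
  refine ⟨fun x y hy hxy => ?_, fun K hK hKc => ?_⟩
  · have hx : 0 ≤ x := hy.trans hxy.le
    have hμ := G0_lasso_jump (lam0 := lam0) (θ := θ) (ε := ε) h.μ_Iic h.μ_Ioi_lt_top h.continuous
      hy hxy (h.integrableOn_μ_Ioi hy)
    have hν := G0_lasso_jump (lam0 := lam0) (θ := θ) (ε := ε) h.ν_Iic h.ν_Ioi_lt_top h.continuous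
      hy hxy (h.integrableOn_ν_Ioi hy)
    exact ⟨(G0_immigration_jump h.ν_int hy hxy (h.V_ν x hx) (h.V_ν y hy)).1,
      (G0_single_branching_jump h.μ_int hl h.differentiable hy hxy (h.V_μ x hx)).1,
      (G0_common_branching_jump h.μ_int h.differentiable hy hxy (h.V_μ x hx) (h.V_μ y hy)).1,
      hμ.1, hμ.2.1, hν.1, hν.2.1⟩
  · rcases K.eq_empty_or_nonempty with rfl | hne
    · exact ⟨0, by simp⟩
    obtain ⟨p, hp, hpmax⟩ := hKc.exists_isMaxOn hne continuous_fst.continuousOn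
    obtain ⟨q, hq, hqmin⟩ := hKc.exists_isMinOn hne
      (f := fun r : ℝ × ℝ => r.1 - r.2) (by fun_prop)
    obtain ⟨C, hC⟩ := h.exists_neg_le_Ltil_G0 hc hβ hl hθ hε
      ((hK hp).1.trans (hK hp).2.le) (sub_pos.2 (hK hq).2) hg0 hgmono hΨ
    refine ⟨max C 0, fun r hr => abs_le.2 ⟨?_, ?_⟩⟩
    · exact (neg_le_neg (le_max_left _ _)).trans
        (hC r.1 r.2 (hK hr).1 (hpmax hr) (hqmin hr))
    · exact (hnonpos r.1 r.2 (hK hr).1 (hK hr).2).trans (le_max_right _ _)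

end JumpRegular

/- Proposition 5.1 of Li–Li–Wang–Zhou: under Conditions 1.1 and 1.2 and the
Lyapunov condition (Condition 1.3) for a nonnegative `C²` function `V` with
`V(x) → ∞` and `LV ≤ C₀ − C₁ V` on `[0,∞)`, there are constants `x₀ ∈ (0,1)`,
`θ ≥ 4`, `ε > 0` and `λ > 0` such that `G₀ = εF₀ + V₀` lies in the domain of
the coupling generator `L̃` and `L̃G₀(x,y) ≤ −λ G₀(x,y)` on `Δᶜ`; one may take
`λ = (C₁ ∧ λ₂)/2`, where `λ₂ > 0` is the contraction constant for `F₀`. -/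
theorem coupling_generator_G0_contraction
    (b c β lam0 : ℝ) (hc : 0 ≤ c) (hβ : 0 ≤ β) (hlam0 : 0 < lam0)
    (μ ν : Measure ℝ)
    (hμsupp : μ (Set.Iic 0) = 0) (hνsupp : ν (Set.Iic 0) = 0)
    (hμloc : ∫⁻ z, ENNReal.ofReal (min 1 (z ^ 2)) ∂μ < ⊤)
    (hνloc : ∫⁻ z, ENNReal.ofReal (min 1 z) ∂ν < ⊤)
    (g : ℝ → ℝ) (hg0 : g 0 = 0) (hgmono : MonotoneOn g (Set.Ici 0))
    (hgcont : ContinuousOn g (Set.Ici 0)) (hgnonneg : ∀ x ∈ Set.Ici (0 : ℝ), 0 ≤ g x)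
    (hPsi : 0 < Psi b c μ lam0) (hPhi : 0 < Phi β ν lam0)
    (hfluct : 0 < c ∨ ∃ c₀ > (0 : ℝ), ∃ κ₀ > (0 : ℝ), ∀ x : ℝ, |x| ≤ c₀ →
      ENNReal.ofReal κ₀ ≤ (μ ⊓ Measure.map (fun z => z + x) μ) (Set.Ioi 0)
        + (ν ⊓ Measure.map (fun z => z + x) ν) (Set.Ioi 0))
    (V : ℝ → ℝ) (hV : ContDiff ℝ 2 V) (hVnonneg : ∀ x ∈ Set.Ici (0 : ℝ), 0 ≤ V x)
    (hVinf : Filter.Tendsto V Filter.atTop Filter.atTop)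
    (hVint : ∀ x : ℝ, 0 ≤ x →
      MeasureTheory.IntegrableOn (fun z => V (x + z) - V x - deriv V x * cutoff z)
        (Set.Ioi 0) μ ∧
      MeasureTheory.IntegrableOn (fun z => V (x + z) - V x) (Set.Ioi 0) ν)
    (C₀ C₁ : ℝ) (hC₀ : 0 < C₀) (hC₁ : 0 < C₁)
    (hLyap : ∀ x : ℝ, 0 ≤ x → genL b c β g μ ν V x ≤ C₀ - C₁ * V x) :
    ∃ x0 : ℝ, 0 < x0 ∧ x0 < 1 ∧ ∃ θ : ℝ, 4 ≤ θ ∧ ∃ ε : ℝ, 0 < ε ∧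
      ∃ lam2 : ℝ, 0 < lam2 ∧
        InDomLtil b c β g μ ν (G0 lam0 x0 θ ε V) ∧
        ∀ x y : ℝ, 0 ≤ y → y < x →
          Ltil b c β g μ ν (G0 lam0 x0 θ ε V) x y
            ≤ -(min C₁ lam2 / 2) * G0 lam0 x0 θ ε V x y := by
  have h : JumpRegular μ ν V :=
    { μ_Iic := hμsupp
      ν_Iic := hνsupp
      μ_int := integrableOn_Ioi_of_lintegral_lt_top (by fun_prop) (fun z _ => by positivity) hμloc
      ν_int := integrableOn_Ioi_of_lintegral_lt_top (by fun_prop) (fun z hz => by positivity) hνloc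
      contDiff := hV
      nonneg := hVnonneg
      V_μ := fun t ht => (hVint t ht).1
      V_ν := fun t ht => (hVint t ht).2 }
  obtain ⟨l, hl1, hVl⟩ : ∃ l ≥ (1 : ℝ), ∀ x, l ≤ x → 14 * C₀ / C₁ ≤ V x := by
    obtain ⟨a, ha⟩ := Filter.eventually_atTop.1 (hVinf.eventually_ge_atTop (14 * C₀ / C₁))
    exact ⟨max a 1, le_max_right _ _, fun x hx => ha x ((le_max_left _ _).trans hx)⟩
  obtain ⟨θ, hθ, d, hd, hcontr⟩ :=
    h.exists_contraction hc hβ hlam0 hl1 hg0 hgmono hgcont hPsi hPhi hfluct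
  have hθ0 : 0 < θ := by linarith
  set lam2 := d / (2 * (θ + 1)) with hlam2
  have hlam2pos : 0 < lam2 := by positivity
  have hlam2d : lam2 * (2 * (θ + 1)) = d := div_mul_cancel₀ _ (by positivity)
  set ε := 4 * C₀ / (lam2 * θ) with hε
  have hεpos : 0 < ε := by positivity
  have hεC : ε * (lam2 * θ) = 4 * C₀ := div_mul_cancel₀ _ (by positivity)
  have hεlam : ε * lam2 ≤ C₀ := by
    have : 0 < ε * lam2 := by positivity
    nlinarith
  have hF : ∀ x y : ℝ, 0 ≤ y → y < x →
      θ ≤ (θ + bump x) * (2 - Real.exp (-(lam0 * (x - y)))) ∧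
      (θ + bump x) * (2 - Real.exp (-(lam0 * (x - y)))) ≤ 2 * (θ + 1) := by
    intro x y hy hxy
    have hb0 := bump_nonneg x
    have hb1 := bump_le_one (hy.trans hxy.le)
    have he0 := Real.exp_pos (-(lam0 * (x - y)))
    have he1 : Real.exp (-(lam0 * (x - y))) ≤ 1 :=
      Real.exp_le_one_iff.2 (by linarith [mul_pos hlam0 (sub_pos.2 hxy)])
    constructor <;> nlinarith
  have hmain : ∀ x y : ℝ, 0 ≤ y → y < x → Ltil b c β g μ ν (G0 lam0 (1 / 2) θ ε V) x y
      ≤ -(min C₁ lam2 / 2) * G0 lam0 (1 / 2) θ ε V x y := by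
    intro x y hy hxy
    have hx : 0 ≤ x := hy.trans hxy.le
    obtain ⟨hF1, hF2⟩ := hF x y hy hxy
    obtain ⟨hnear, hfar⟩ := hcontr ε hεpos.le x y hy hxy
    have hLx := hLyap x hx
    have hLy := hLyap y hy
    have hVx := hVnonneg x hx
    have hVy := hVnonneg y hy
    rw [G0_of_lt _ _ _ _ hxy]
    generalize (θ + bump x) * (2 - Real.exp (-(lam0 * (x - y)))) = F at *
    have hF0 : 0 ≤ F := hθ0.le.trans hF1
    have h1 : min C₁ lam2 * (ε * F) ≤ lam2 * (ε * F) := by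
      gcongr
      exact min_le_right _ _
    have h2 : min C₁ lam2 * (V x + V y) ≤ C₁ * (V x + V y) := by
      gcongr
      exact min_le_left _ _
    rcases le_total x l with hxl | hlx
    · have h3 := hnear hxl
      have h4 : ε * (lam2 * F) ≤ ε * d := by
        rw [← hlam2d]
        gcongr
      have h5 : ε * (lam2 * θ) ≤ ε * (lam2 * F) := by gcongr
      have h6 := mul_nonneg hC₁.le (add_nonneg hVx hVy)
      linarith
    · have h3 := hfar hlx
      have h4 : ε * (lam2 * F) ≤ ε * (lam2 * (2 * (θ + 1))) := by gcongr
      have h5 : 14 * C₀ ≤ C₁ * V x := by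
        rw [mul_comm C₁]
        exact (div_le_iff₀ hC₁).1 (hVl x hlx)
      have h6 := mul_nonneg hC₁.le hVy
      linarith
  refine ⟨1 / 2, by norm_num, by norm_num, θ, hθ, ε, hεpos, lam2, hlam2pos, ?_, hmain⟩
  refine h.inDomLtil_G0 hc hβ hlam0 hθ0.le hεpos.le hg0 hgmono hPsi fun x y hy hxy => ?_
  refine (hmain x y hy hxy).trans (mul_nonpos_of_nonpos_of_nonneg ?_ ?_)
  · have : 0 < min C₁ lam2 := by positivity
    linarith
  · rw [G0_of_lt _ _ _ _ hxy]
    have h1 := hθ0.le.trans (hF x y hy hxy).1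
    have h2 := hVnonneg x (hy.trans hxy.le)
    have h3 := hVnonneg y hy
    positivity
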